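/- arXiv:1807.06376 — 4 statements merged into one kernel-verified Lean document; each statement's English description precedes it below -/
import Mathlib

section
/- For every ε > 0 there exists n₀ such that for all n ≥ n₀ and every ℓ with 3 ≤ ℓ ≤ (1-ε)·(log n)/(log log n), there exists a graph G on at least n·log n vertices with independence number α(G) < n and containing no cycle of length ℓ. Consequently r(C_ℓ, K_n) > n·log n. -/
open Finset Filter

/-- The number of colourings with palette `Fin q` that send `T` into `A`. -/
lemma card_filter_forall_mem {E : Type*} [Fintype E] [DecidableEq E] {q : ℕ}
    (T : Finset E) (A : Finset (Fin q)) :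
    #{c : E → Fin q | ∀ e ∈ T, c e ∈ A} * q ^ #T = #A ^ #T * q ^ Fintype.card E := by
  have h : ({c : E → Fin q | ∀ e ∈ T, c e ∈ A} : Finset _) =
      Fintype.piFinset fun e => if e ∈ T then A else univ := by
    ext c
    simp only [mem_filter, mem_univ, true_and, Fintype.mem_piFinset]
    refine forall_congr' fun e => ?_
    split_ifs <;> simp_all
  have hcard : ∏ e, #(if e ∈ T then A else univ) = #A ^ #T * q ^ #Tᶜ := by
    rw [← prod_mul_prod_compl T]
    congr 1
    · exact (prod_congr rfl fun e he => by rw [if_pos he]).trans (by simp)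
    · exact (prod_congr rfl fun e he => by rw [if_neg (mem_compl.1 he)]).trans (by simp)
  rw [h, Fintype.card_piFinset, hcard, mul_assoc, ← pow_add, add_comm, card_add_card_compl]

/-- The graph whose edges are the pairs of distinct vertices of colour `0`. -/
def zeroColorGraph {V : Type*} {q : ℕ} [NeZero q] (c : Sym2 V → Fin q) : SimpleGraph V where
  Adj u v := u ≠ v ∧ c s(u, v) = 0
  symm := ⟨fun u v h => ⟨h.1.symm, by rw [Sym2.eq_swap]; exact h.2⟩⟩
  loopless := ⟨fun u h => h.1 rfl⟩

lemma cycle_edges_injective {V : Type*} {k : ℕ} {f : Fin (k + 3) → V}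
    (hf : Function.Injective f) : Function.Injective fun i => s(f i, f (i + 1)) := by
  intro i j hij
  simp only [Sym2.eq_iff] at hij
  obtain ⟨h, -⟩ | ⟨h₁, h₂⟩ := hij
  · exact hf h
  · have h₁ := hf h₁
    have h₂ := hf h₂
    rw [h₁, add_assoc] at h₂
    have h₃ : (1 + 1 : Fin (k + 3)) = 0 := by simpa using h₂
    simp only [Fin.ext_iff, Fin.val_add, Fin.val_one, Fin.val_zero] at h₃
    rw [Nat.mod_eq_of_lt (by omega)] at h₃
    omega

/-- The vertex sequence of a cycle of length `k + 3`. -/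
lemma SimpleGraph.Walk.IsCycle.exists_injective {V : Type*} {G : SimpleGraph V} {k : ℕ} {x : V}
    {w : G.Walk x x} (hw : w.IsCycle) (hl : w.length = k + 3) :
    ∃ f : Fin (k + 3) → V, Function.Injective f ∧ ∀ i, G.Adj (f i) (f (i + 1)) := by
  refine ⟨fun i => w.getVert i, fun i j hij => Fin.ext ?_, fun i => ?_⟩
  · exact hw.getVert_injOn' (by simp; omega) (by simp; omega) hij
  · have hadj := w.adj_getVert_succ (i := i) (by omega)
    by_cases hi : i = Fin.last _
    · subst hi
      have : w.getVert (k + 3) = x := by rw [← hl]; exact w.getVert_length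
      simpa [this] using hadj
    · change G.Adj (w.getVert i) (w.getVert ↑(i + 1))
      rw [Fin.val_add_one_of_lt (Fin.lt_last_iff_ne_last.2 hi)]
      exact hadj

/-- The first moment bound for monochromatic cycles. -/
lemma sum_card_cycles_le {V : Type*} [Fintype V] [DecidableEq V] {q : ℕ} [NeZero q] (k : ℕ) :
    (∑ c : Sym2 V → Fin q, (#{f : Fin (k + 3) → V | Function.Injective f ∧
        ∀ i, c s(f i, f (i + 1)) = 0} : ℝ)) ≤
      (Fintype.card V / q : ℝ) ^ (k + 3) * (q : ℝ) ^ Fintype.card (Sym2 V) := by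
  have hq : (0 : ℝ) < q := by exact_mod_cast NeZero.pos q
  have hone (f : Fin (k + 3) → V) : (#{c : Sym2 V → Fin q | Function.Injective f ∧
      ∀ i, c s(f i, f (i + 1)) = 0} : ℝ) ≤
        (q : ℝ) ^ Fintype.card (Sym2 V) / (q : ℝ) ^ (k + 3) := by
    by_cases hf : Function.Injective f
    · have h := card_filter_forall_mem (univ.image fun i => s(f i, f (i + 1))) {(0 : Fin q)}
      rw [card_image_of_injective _ (cycle_edges_injective hf)] at h
      simp only [mem_image, mem_univ, true_and, forall_exists_index, forall_apply_eq_imp_iff,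
        mem_singleton, card_fin, card_singleton, one_pow, one_mul] at h
      rw [le_div_iff₀ (by positivity)]
      simp only [hf, true_and]
      exact_mod_cast h.le
    · simp only [hf, false_and, filter_false, card_empty, Nat.cast_zero]
      positivity
  calc _ = ∑ f : Fin (k + 3) → V, (#{c : Sym2 V → Fin q | Function.Injective f ∧
        ∀ i, c s(f i, f (i + 1)) = 0} : ℝ) := by
        exact_mod_cast sum_card_bipartiteAbove_eq_sum_card_bipartiteBelow
          (s := univ) (t := univ) (fun (c : Sym2 V → Fin q) (f : Fin (k + 3) → V) =>
            Function.Injective f ∧ ∀ i, c s(f i, f (i + 1)) = 0)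
    _ ≤ ∑ _f : Fin (k + 3) → V, (q : ℝ) ^ Fintype.card (Sym2 V) / (q : ℝ) ^ (k + 3) :=
        sum_le_sum fun f _ => hone f
    _ = _ := by
        simp only [sum_const, card_univ, Fintype.card_fun, Fintype.card_fin, nsmul_eq_mul, div_pow]
        push_cast
        ring

/-- The first moment of the number of independent sets of size `n`. -/
lemma sum_card_indep_eq {V : Type*} [Fintype V] [DecidableEq V] {q : ℕ} [NeZero q] (n : ℕ) :
    (∑ c : Sym2 V → Fin q, (#{s ∈ powersetCard n (univ : Finset V) |
        ∀ e ∈ s.offDiag.image Sym2.mk.uncurry, c e ∈ ({0}ᶜ : Finset (Fin q))} : ℝ)) =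
      (Fintype.card V).choose n * (1 - 1 / q : ℝ) ^ n.choose 2 *
        (q : ℝ) ^ Fintype.card (Sym2 V) := by
  have hq : (0 : ℝ) < q := by exact_mod_cast NeZero.pos q
  have hone (s : Finset V) (hs : s ∈ powersetCard n univ) : (#{c : Sym2 V → Fin q |
      ∀ e ∈ s.offDiag.image Sym2.mk.uncurry, c e ∈ ({0}ᶜ : Finset (Fin q))} : ℝ) =
        (1 - 1 / q : ℝ) ^ n.choose 2 * (q : ℝ) ^ Fintype.card (Sym2 V) := by
    have h := card_filter_forall_mem (s.offDiag.image Sym2.mk.uncurry) ({0}ᶜ : Finset (Fin q))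
    rw [Sym2.card_image_offDiag, (mem_powersetCard.1 hs).2, card_compl, card_singleton,
      Fintype.card_fin] at h
    have h' := congrArg (Nat.cast : ℕ → ℝ) h
    push_cast [Nat.cast_sub (NeZero.one_le : 1 ≤ q)] at h'
    have hsub : (1 - 1 / q : ℝ) = (q - 1) / q := by field_simp
    rw [hsub, div_pow, div_mul_eq_mul_div, eq_div_iff (by positivity)]
    exact h'
  calc _ = ∑ s ∈ powersetCard n (univ : Finset V), (#{c : Sym2 V → Fin q |
        ∀ e ∈ s.offDiag.image Sym2.mk.uncurry, c e ∈ ({0}ᶜ : Finset (Fin q))} : ℝ) := by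
        exact_mod_cast sum_card_bipartiteAbove_eq_sum_card_bipartiteBelow
          (s := univ) (t := powersetCard n (univ : Finset V))
          (fun (c : Sym2 V → Fin q) (s : Finset V) =>
            ∀ e ∈ s.offDiag.image Sym2.mk.uncurry, c e ∈ ({0}ᶜ : Finset (Fin q)))
    _ = _ := by
        rw [sum_congr rfl hone]
        simp [mul_assoc]

/-- The alteration method: if the first moments are small, some random graph has no independent
set of size `n`, and deleting fewer than `n` vertices destroys all its `(k + 3)`-cycles. -/
lemma exists_graph_of_first_moment {N n k q : ℕ} (hq : 0 < q)
    (h : n * (N.choose n * (1 - 1 / q : ℝ) ^ n.choose 2) + (N / q : ℝ) ^ (k + 3) < n) :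
    ∃ (V : Type) (_ : Fintype V) (G : SimpleGraph V), N ≤ Fintype.card V + n ∧
      (∀ s : Finset V, (∀ u ∈ s, ∀ v ∈ s, u ≠ v → ¬ G.Adj u v) → #s < n) ∧
      ¬ ∃ (x : V) (w : G.Walk x x), w.IsCycle ∧ w.length = k + 3 := by
  have : NeZero q := ⟨hq.ne'⟩
  obtain ⟨c, -, hc⟩ : ∃ c ∈ (univ : Finset (Sym2 (Fin N) → Fin q)),
      n * (#{s ∈ powersetCard n (univ : Finset (Fin N)) |
        ∀ e ∈ s.offDiag.image Sym2.mk.uncurry, c e ∈ ({0}ᶜ : Finset (Fin q))} : ℝ) +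
      (#{f : Fin (k + 3) → Fin N | Function.Injective f ∧
        ∀ i, c s(f i, f (i + 1)) = 0} : ℝ) < n := by
    apply exists_lt_of_sum_lt
    rw [sum_add_distrib, ← mul_sum, sum_card_indep_eq]
    refine (add_le_add_right (sum_card_cycles_le k) _).trans_lt ?_
    simp only [sum_const, card_univ, Fintype.card_fun, Fintype.card_fin, nsmul_eq_mul]
    push_cast
    have hpos : (0 : ℝ) < (q : ℝ) ^ Fintype.card (Sym2 (Fin N)) := by positivity
    nlinarith [mul_lt_mul_of_pos_right h hpos]
  set I := {s ∈ powersetCard n (univ : Finset (Fin N)) |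
    ∀ e ∈ s.offDiag.image Sym2.mk.uncurry, c e ∈ ({0}ᶜ : Finset (Fin q))} with hI
  set X : Finset (Fin (k + 3) → Fin N) := {f | Function.Injective f ∧
    ∀ i, c s(f i, f (i + 1)) = 0} with hX
  norm_cast at hc
  have hI0 : I = ∅ := by
    rw [← card_eq_zero]
    by_contra h0
    nlinarith [Nat.pos_of_ne_zero h0]
  let D := X.image fun f => f 0
  refine ⟨{v // v ∉ D}, inferInstance, (zeroColorGraph c).comap Subtype.val, ?_, ?_, ?_⟩
  · have hD : #D ≤ #X := card_image_le
    have : Fintype.card {v // v ∉ D} = N - #D := by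
      simp [Fintype.card_subtype_compl]
    have hXn : #X < n := by omega
    omega
  · intro s hs
    by_contra! hn
    obtain ⟨t, hts, ht⟩ := exists_subset_card_eq hn
    have : t.map (Function.Embedding.subtype _) ∈ I := by
      rw [hI]
      simp only [mem_filter, mem_powersetCard, subset_univ, card_map, ht, mem_image, Prod.exists,
        mem_offDiag, Finset.mem_map, true_and, mem_compl, mem_singleton]
      rintro e ⟨a, b, ⟨⟨u, hu, rfl⟩, ⟨v, hv, rfl⟩, huv⟩, rfl⟩ h0
      exact hs u (hts hu) v (hts hv) (fun h => huv (by rw [h])) ⟨huv, h0⟩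
    simp [hI0] at this
  · rintro ⟨x, w, hw, hl⟩
    obtain ⟨f, hf, hadj⟩ := hw.exists_injective hl
    refine (f 0).2 (mem_image.2 ⟨fun i => (f i : Fin N), ?_, rfl⟩)
    simp only [hX, mem_filter, mem_univ, true_and]
    exact ⟨Subtype.val_injective.comp hf, fun i => (hadj i).2⟩

/-- The expected number of independent sets of size `n` is exponentially small. -/
lemma choose_mul_pow_le {n N q : ℕ} {D x : ℝ} (hn : 2 ≤ n) (hq : 0 < q) (hN : N ≤ n * x)
    (hx : 0 < x) (hD : D = Real.log x + 2) (hqD : q * (2 * D) ≤ n - 1) :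
    (N.choose n : ℝ) * (1 - 1 / q : ℝ) ^ n.choose 2 ≤ Real.exp (-n) := by
  have hn0 : (0 : ℝ) < n := by positivity
  have hq0 : (1 : ℝ) ≤ q := by exact_mod_cast hq
  have h0 : (0 : ℝ) ≤ 1 - 1 / q := by
    rw [sub_nonneg, div_le_one (by positivity)]
    exact hq0
  have hchoose : (N.choose n : ℝ) ≤ Real.exp (n * (1 + Real.log x)) := by
    calc (N.choose n : ℝ) ≤ (N : ℝ) ^ n / n.factorial := Nat.choose_le_pow_div n N
      _ ≤ (n * x) ^ n / n.factorial := by gcongr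
      _ = (n : ℝ) ^ n / n.factorial * x ^ n := by rw [mul_pow]; ring
      _ ≤ Real.exp n * x ^ n := by
          gcongr
          exact Real.pow_div_factorial_le_exp n hn0.le n
      _ = Real.exp (n * (1 + Real.log x)) := by
          rw [mul_add, mul_one, Real.exp_add, Real.exp_nat_mul, Real.exp_log hx]
  have hpow : (1 - 1 / q : ℝ) ^ n.choose 2 ≤ Real.exp (-(n * D)) := by
    calc (1 - 1 / q : ℝ) ^ n.choose 2 ≤ Real.exp (-(1 / q)) ^ n.choose 2 := by
          gcongr
          exact Real.one_sub_le_exp_neg _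
      _ = Real.exp (-(n * (n - 1) / 2 / q)) := by
          rw [← Real.exp_nat_mul, Nat.cast_choose_two]
          congr 1
          ring
      _ ≤ Real.exp (-(n * D)) := by
          gcongr
          rw [le_div_iff₀ (by positivity)]
          nlinarith
  calc _ ≤ Real.exp (n * (1 + Real.log x)) * Real.exp (-(n * D)) := by gcongr
    _ = _ := by
      rw [← Real.exp_add, hD]
      congr 1
      ring

lemma eventually_mul_log_le_rpow {ε : ℝ} (hε : 0 < ε) :
    ∀ᶠ L : ℝ in atTop, 4 * (Real.log (L + 2) + 2) * (L + 2) ≤ L ^ (1 + ε) := by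
  have ho := (isLittleO_log_rpow_atTop hε).def (show (0 : ℝ) < 1 / 24 by norm_num)
  filter_upwards [ho, eventually_ge_atTop 2, Real.tendsto_log_atTop.eventually_ge_atTop 2]
    with L hL hL2 hlog
  have hlog2 : Real.log (L + 2) ≤ 2 * Real.log L := by
    rw [← Real.log_rpow (by positivity)]
    refine Real.log_le_log (by positivity) ?_
    norm_num
    nlinarith
  have hpow : 0 < L ^ ε := by positivity
  rw [Real.norm_of_nonneg (by positivity), Real.norm_of_nonneg hpow.le] at hL
  rw [Real.rpow_add (by positivity), Real.rpow_one]
  calc 4 * (Real.log (L + 2) + 2) * (L + 2) ≤ 4 * (1 / 8 * L ^ ε) * (2 * L) := by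
        gcongr <;> linarith
    _ = L * L ^ ε := by ring

lemma eventually_logb_rpow_le (r : ℝ) : ∀ᶠ x : ℝ in atTop, Real.logb 2 x ^ r ≤ x := by
  have hlog : 0 < Real.log 2 := Real.log_pos (by norm_num)
  have ho := (isLittleO_log_rpow_rpow_atTop r one_pos).def
    (show (0 : ℝ) < Real.log 2 ^ r by positivity)
  filter_upwards [ho, eventually_ge_atTop 1] with x hx hx1
  have hlogx : 0 ≤ Real.log x := Real.log_nonneg hx1
  rw [Real.norm_of_nonneg (by positivity), Real.norm_of_nonneg (by positivity),
    Real.rpow_one] at hx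
  rw [Real.logb, Real.div_rpow hlogx hlog.le, div_le_iff₀ (by positivity), mul_comm]
  exact hx

/-- The expected number of `ℓ`-cycles is at most `n / 2`. -/
lemma rpow_pow_le_half {ε L : ℝ} {n ℓ : ℕ} (hε : 0 < ε) (hn : 0 < n) (hL : L = Real.logb 2 n)
    (hL1 : 1 < L) (hℓ : ℓ ≤ (1 - ε) * L / Real.logb 2 L) (hn2 : 2 ≤ (n : ℝ) ^ (ε ^ 2)) :
    (L ^ (1 + ε)) ^ ℓ ≤ n / 2 := by
  have hn0 : (0 : ℝ) < n := by positivity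
  have hlog2 : 0 < Real.log 2 := Real.log_pos (by norm_num)
  have hlogL : 0 < Real.log L := Real.log_pos hL1
  rw [le_div_iff₀ (Real.logb_pos (by norm_num) hL1)] at hℓ
  have hℓ' : ℓ * Real.log L ≤ (1 - ε) * Real.log n := by
    rw [Real.logb] at hℓ
    have h := mul_le_mul_of_nonneg_right hℓ hlog2.le
    have hLn : L * Real.log 2 = Real.log n := by
      rw [hL, Real.logb]
      field_simp
    rwa [mul_assoc, div_mul_cancel₀ _ hlog2.ne', mul_assoc, hLn] at h
  calc (L ^ (1 + ε)) ^ ℓ = Real.exp ((1 + ε) * (ℓ * Real.log L)) := by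
        rw [← Real.rpow_mul_natCast (by positivity), Real.rpow_def_of_pos (by positivity)]
        congr 1
        ring
    _ ≤ Real.exp ((1 + ε) * ((1 - ε) * Real.log n)) := by gcongr
    _ = n / (n : ℝ) ^ (ε ^ 2) := by
        nth_rewrite 2 [← Real.rpow_one (n : ℝ)]
        rw [← Real.rpow_sub hn0, Real.rpow_def_of_pos hn0]
        congr 1
        ring
    _ ≤ n / 2 := by gcongr

/-- Lower bound theorem: for every `ε > 0` there is `n₀` such that for all `n ≥ n₀` and all
`ℓ` with `3 ≤ ℓ ≤ (1-ε) log n / log log n` (logs base 2), there is a graph on at least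
`n log n` vertices with independence number `< n` and no cycle of length `ℓ`.
Consequently `r(C_ℓ, K_n) > n log n`. -/
theorem stmt6 (ε : ℝ) (hε : 0 < ε) :
    ∃ n₀ : ℕ, ∀ n : ℕ, n₀ ≤ n → ∀ ℓ : ℕ, 3 ≤ ℓ →
      (ℓ : ℝ) ≤ (1 - ε) * Real.logb 2 n / Real.logb 2 (Real.logb 2 n) →
      ∃ (V : Type) (inst : Fintype V) (G : SimpleGraph V),
        (n : ℝ) * Real.logb 2 n ≤ (@Fintype.card V inst : ℝ) ∧
        (∀ s : Finset V, (∀ u ∈ s, ∀ v ∈ s, u ≠ v → ¬ G.Adj u v) → s.card < n) ∧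
        ¬ ∃ (x : V) (w : G.Walk x x), w.IsCycle ∧ w.length = ℓ := by
  have hcast : Tendsto (fun n : ℕ => (n : ℝ)) atTop atTop := tendsto_natCast_atTop_atTop
  have hlogb := (Real.tendsto_logb_atTop (b := 2) (by norm_num)).comp hcast
  have hrpow := (tendsto_rpow_atTop (show 0 < ε ^ 2 by positivity)).comp hcast
  obtain ⟨n₀, hn₀⟩ := eventually_atTop.1 <|
    (hlogb.eventually (eventually_mul_log_le_rpow hε)).and <|
    (hcast.eventually (eventually_logb_rpow_le (1 + ε))).and <|
    (hrpow.eventually_ge_atTop 2).and <| (hlogb.eventually_gt_atTop 1).and <|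
    eventually_ge_atTop 2
  refine ⟨n₀, fun n hn ℓ hℓ hℓle => ?_⟩
  obtain ⟨hlog, hLn, hn2, hL1, hn2'⟩ := hn₀ n hn
  simp only [Function.comp_apply] at hlog hLn hn2 hL1
  obtain ⟨k, rfl⟩ := Nat.exists_eq_add_of_le' hℓ
  set L := Real.logb 2 n with hL
  set D := Real.log (L + 2) + 2 with hD
  have hn0 : (2 : ℝ) ≤ n := by exact_mod_cast hn2'
  have hD2 : 2 ≤ D := by
    have : 0 ≤ Real.log (L + 2) := Real.log_nonneg (by linarith)
    linarith
  have hDn : 4 * D + 2 ≤ n := by nlinarith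
  set q := ⌊((n : ℝ) - 1) / (2 * D)⌋₊ with hq
  have hqD : q * (2 * D) ≤ (n : ℝ) - 1 := by
    rw [← le_div_iff₀ (by positivity)]
    exact Nat.floor_le (div_nonneg (by linarith) (by positivity))
  have hqn : n ≤ q * (4 * D) := by
    have h := Nat.lt_floor_add_one (((n : ℝ) - 1) / (2 * D))
    rw [div_lt_iff₀ (by positivity)] at h
    linarith
  have hq0 : 0 < q := by
    rw [Nat.pos_iff_ne_zero]
    intro h0
    rw [h0, Nat.cast_zero, zero_mul] at hqn
    linarith
  set N := ⌈n * L⌉₊ + n with hN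
  have hNle : (N : ℝ) ≤ n * (L + 2) := by
    have := Nat.ceil_lt_add_one (show 0 ≤ n * L by positivity)
    push_cast [hN]
    linarith
  have hNq : (N / q : ℝ) ≤ L ^ (1 + ε) := by
    rw [div_le_iff₀ (by positivity)]
    calc (N : ℝ) ≤ n * (L + 2) := hNle
      _ ≤ q * (4 * D) * (L + 2) := by gcongr
      _ = 4 * D * (L + 2) * q := by ring
      _ ≤ L ^ (1 + ε) * q := by gcongr
  have hcycles : (N / q : ℝ) ^ (k + 3) ≤ n / 2 :=
    (pow_le_pow_left₀ (by positivity) hNq _).trans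
      (rpow_pow_le_half hε (by omega) hL hL1 hℓle hn2)
  have hindep := choose_mul_pow_le hn2' hq0 hNle (by positivity) hD hqD
  have hexp : Real.exp (-n) < 1 / 2 := by
    rw [Real.exp_neg, ← one_div]
    exact one_div_lt_one_div_of_lt (by norm_num) (by linarith [Real.add_one_le_exp (n : ℝ)])
  obtain ⟨V, inst, G, hcard, hα, hcyc⟩ :=
    exists_graph_of_first_moment (N := N) (n := n) (k := k) hq0 (by nlinarith)
  refine ⟨V, inst, G, ?_, hα, hcyc⟩
  exact (Nat.le_ceil _).trans (by exact_mod_cast (by omega : ⌈n * L⌉₊ ≤ Fintype.card V))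
end

section
/- Any graph G on v(G) ≥ 3 vertices with minimum degree δ(G) ≥ v(G)/2 is either the complete bipartite graph K_{v(G)/2, v(G)/2} or is pancyclic, i.e. contains cycles of every length ℓ with 3 ≤ ℓ ≤ v(G). -/
namespace SimpleGraph

variable {V : Type*} {G : SimpleGraph V}

/-- `G` contains a cycle of length `ℓ`. -/
def HasCycle (G : SimpleGraph V) (ℓ : ℕ) : Prop :=
  ∃ (x : V) (w : G.Walk x x), w.IsCycle ∧ w.length = ℓ

/-- `f 0, …, f (k - 1)` is a path on `k` vertices. -/
structure IsPathSeq (G : SimpleGraph V) (k : ℕ) (f : ℕ → V) : Prop where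
  inj : ∀ a b, a < k → b < k → f a = f b → a = b
  adj : ∀ a, a + 1 < k → G.Adj (f a) (f (a + 1))

/-- `v` runs periodically around a cycle on `k` vertices. -/
structure IsCyclicSeq (G : SimpleGraph V) (k : ℕ) (v : ℕ → V) : Prop where
  periodic : ∀ a, v (a + k) = v a
  inj : ∀ a b, v a = v b → a ≡ b [MOD k]
  adj : ∀ a, G.Adj (v a) (v (a + 1))

theorem IsPathSeq.exists_walk {m : ℕ} {f : ℕ → V} (hf : G.IsPathSeq (m + 1) f) :
    ∃ p : G.Walk (f 0) (f m), p.IsPath ∧ p.length = m ∧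
      (∀ x ∈ p.support, ∃ a ≤ m, x = f a) ∧
      ∀ e ∈ p.edges, ∃ a < m, e = s(f a, f (a + 1)) := by
  induction m with
  | zero => exact ⟨.nil, by simp⟩
  | succ m ih =>
    obtain ⟨p, hp, hl, hs, he⟩ := ih
      ⟨fun a b ha hb => hf.inj a b (by omega) (by omega), fun a ha => hf.adj a (by omega)⟩
    refine ⟨p.concat (hf.adj m (by omega)), ?_, by simp [hl], ?_, ?_⟩
    · refine hp.concat (fun hmem => ?_) _
      obtain ⟨a, ha, h⟩ := hs _ hmem
      have := hf.inj _ _ (by omega) (by omega) h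
      omega
    · intro x hx
      rw [Walk.support_concat, List.mem_append, List.mem_singleton] at hx
      rcases hx with hx | rfl
      · obtain ⟨a, ha, rfl⟩ := hs x hx
        exact ⟨a, by omega, rfl⟩
      · exact ⟨m + 1, le_rfl, rfl⟩
    · intro e h
      rw [Walk.edges_concat, List.concat_eq_append, List.mem_append, List.mem_singleton] at h
      rcases h with h | rfl
      · obtain ⟨a, ha, rfl⟩ := he e h
        exact ⟨a, by omega, rfl⟩
      · exact ⟨m, by omega, rfl⟩

theorem IsPathSeq.hasCycle {ℓ : ℕ} {f : ℕ → V} (hf : G.IsPathSeq ℓ f) (hℓ : 3 ≤ ℓ)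
    (hc : G.Adj (f (ℓ - 1)) (f 0)) : G.HasCycle ℓ := by
  obtain ⟨m, rfl⟩ : ∃ m, ℓ = m + 1 := ⟨ℓ - 1, by omega⟩
  obtain ⟨p, hp, hl, -, he⟩ := hf.exists_walk
  refine ⟨_, .cons hc p, (Walk.cons_isCycle_iff p hc).2 ⟨hp, fun hmem => ?_⟩, by simp [hl]⟩
  obtain ⟨a, ha, h⟩ := he _ hmem
  rw [Sym2.eq_iff] at h
  rcases h with ⟨h₁, h₂⟩ | ⟨h₁, h₂⟩
  · have := hf.inj _ _ (by omega) (by omega) h₂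
    omega
  · have := hf.inj _ _ (by omega) (by omega) h₁
    have := hf.inj _ _ (by omega) (by omega) h₂
    omega

namespace IsCyclicSeq

variable {n : ℕ} {v : ℕ → V}

theorem eq_of_mem_window (hv : G.IsCyclicSeq n v) (i : ℕ) {a b : ℕ} (h : v a = v b)
    (ha : i ≤ a) (ha' : a < i + n) (hb : i ≤ b) (hb' : b < i + n) : a = b := by
  have h := hv.inj a b h
  rcases le_total a b with hab | hab
  · have := Nat.eq_zero_of_dvd_of_lt ((Nat.modEq_iff_dvd' hab).1 h) (by omega)
    omega
  · have := Nat.eq_zero_of_dvd_of_lt ((Nat.modEq_iff_dvd' hab).1 h.symm) (by omega)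
    omega

theorem periodic_mul (hv : G.IsCyclicSeq n v) (a j : ℕ) : v (a + j * n) = v a := by
  induction j with
  | zero => simp
  | succ j ih => rw [Nat.succ_mul, ← Nat.add_assoc, hv.periodic, ih]

/-- A closed sequence of positions `g` inside one period, with consecutive positions joined by
edges, is a cycle. -/
theorem hasCycle_of_positions (hv : G.IsCyclicSeq n v) (i : ℕ) {ℓ : ℕ} (hℓ : 3 ≤ ℓ) (g : ℕ → ℕ)
    (hg : ∀ t < ℓ, i ≤ g t ∧ g t < i + n) (hinj : ∀ a b, a < ℓ → b < ℓ → g a = g b → a = b)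
    (hadj : ∀ t, t + 1 < ℓ → G.Adj (v (g t)) (v (g (t + 1))))
    (hc : G.Adj (v (g (ℓ - 1))) (v (g 0))) : G.HasCycle ℓ :=
  IsPathSeq.hasCycle (f := fun t => v (g t))
    ⟨fun a b ha hb h => hinj a b ha hb (hv.eq_of_mem_window i h (hg a ha).1 (hg a ha).2
      (hg b hb).1 (hg b hb).2), hadj⟩ hℓ hc

theorem adj_of_succ_eq (hv : G.IsCyclicSeq n v) {a b : ℕ} (h : a + 1 = b ∨ b + 1 = a) :
    G.Adj (v a) (v b) := by
  rcases h with rfl | rfl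
  · exact hv.adj a
  · exact (hv.adj b).symm

/-- Two non-crossing chords joining the consecutive vertices `x`, `w` to `z`, `y`. -/
theorem hasCycle_of_noncrossing (hv : G.IsCyclicSeq n v) {i x w y z s : ℕ} (hs : 1 ≤ s)
    (hx : x = i ∧ w = i + 1 ∨ x = i + 1 ∧ w = i)
    (hy : i + 2 ≤ y) (hyz : z + 1 = y + s) (hz : z < i + n)
    (h₁ : G.Adj (v w) (v y)) (h₂ : G.Adj (v x) (v z)) : G.HasCycle (s + 2) := by
  refine hv.hasCycle_of_positions i (by omega)
    (fun t => if t = 0 then x else if t = 1 then w else y + (t - 2)) ?_ ?_ ?_ ?_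
  · intro t ht
    split_ifs <;> omega
  · intro a b ha hb h
    split_ifs at h <;> omega
  · intro t ht
    by_cases h : t = 1
    · subst h
      simpa using h₁
    · refine hv.adj_of_succ_eq ?_
      rw [if_neg (Nat.succ_ne_zero t)]
      split_ifs <;> omega
  · convert h₂.symm using 2
    · split_ifs <;> omega
    · simp

/-- Two crossing chords `i, i + d` and `i + p, i + d + q`. -/
theorem hasCycle_of_crossing (hv : G.IsCyclicSeq n v) {i d p q s : ℕ} (hs : 1 ≤ s)
    (hp : 1 ≤ p) (hpd : p ≤ d) (hq : 1 ≤ q) (hdq : d + q ≤ n) (hpq : p + q + s = n)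
    (h₁ : G.Adj (v i) (v (i + d))) (h₂ : G.Adj (v (i + p)) (v (i + d + q))) :
    G.HasCycle (s + 2) := by
  refine hv.hasCycle_of_positions (i + 1) (by omega)
    (fun t => if t ≤ d - p then i + d - t else i + d + q + (t - (d - p + 1))) ?_ ?_ ?_ ?_
  · intro t ht
    split_ifs <;> omega
  · intro a b ha hb h
    split_ifs at h <;> omega
  · intro t ht
    by_cases h : t = d - p
    · subst h
      convert h₂ using 2
      · simp only [le_refl, if_true]; omega
      · rw [if_neg (by omega)]; omega
    · refine hv.adj_of_succ_eq ?_
      split_ifs <;> omega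
  · convert h₁ using 1
    · rw [if_neg (by omega), ← hv.periodic i]
      congr 1
      omega
    · simp

/-- The chord at `i + 1` which together with the chord `i, i + x` would close a cycle of
length `s + 2`. -/
def chordShift (n s x : ℕ) : ℕ := if s < x then x - s else x + (n - 2 - s)

theorem hasCycle_of_chordShift {s : ℕ} (hv : G.IsCyclicSeq n v) (hs : 1 ≤ s)
    (hsn : s + 3 ≤ n) {i x : ℕ} (hx : 2 ≤ x) (hxn : x < n) (h₁ : G.Adj (v i) (v (i + x)))
    (h₂ : G.Adj (v (i + 1)) (v (i + 1 + chordShift n s x))) : G.HasCycle (s + 2) := by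
  unfold chordShift at h₂
  split_ifs at h₂ with h
  · exact hv.hasCycle_of_noncrossing hs (.inl ⟨rfl, rfl⟩) (by omega) (by omega) (by omega) h₂ h₁
  · refine hv.hasCycle_of_crossing (p := 1) (q := n - 1 - s) hs le_rfl (by omega) (by omega)
      (by omega) (by omega) h₁ ?_
    rwa [show i + x + (n - 1 - s) = i + 1 + (x + (n - 2 - s)) by omega]

/-- If all chords of length two are present, there are cycles of all lengths. -/
theorem hasCycle_of_adj_add_two (hv : G.IsCyclicSeq n v) (h : ∀ i, G.Adj (v i) (v (i + 2)))
    {ℓ : ℕ} (hℓ : 3 ≤ ℓ) (hn : ℓ ≤ n) : G.HasCycle ℓ := by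
  have key : ∀ a b, a + 1 = b ∨ b + 1 = a ∨ a + 2 = b ∨ b + 2 = a → G.Adj (v a) (v b) := by
    rintro a b (hab | hab | rfl | rfl)
    · exact hv.adj_of_succ_eq (.inl hab)
    · exact hv.adj_of_succ_eq (.inr hab)
    · exact h a
    · exact (h b).symm
  refine hv.hasCycle_of_positions 0 hℓ
    (fun t => if 2 * t < ℓ then 2 * t else 2 * ℓ - 2 * t - 1) ?_ ?_ ?_ ?_
  · intro t ht
    split_ifs <;> omega
  · intro a b ha hb h
    split_ifs at h <;> omega
  · intro t ht
    refine key _ _ ?_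
    split_ifs <;> omega
  · refine key _ _ ?_
    split_ifs <;> omega

end IsCyclicSeq

section Dirac

variable {k : ℕ} {f : ℕ → V}

theorem IsPathSeq.reverse (hf : G.IsPathSeq k f) : G.IsPathSeq k fun t => f (k - 1 - t) where
  inj a b ha hb h := by
    have := hf.inj _ _ (by omega) (by omega) h
    omega
  adj a ha := by
    have h := (hf.adj (k - 1 - (a + 1)) (by omega)).symm
    rwa [show k - 1 - (a + 1) + 1 = k - 1 - a by omega] at h

theorem IsPathSeq.snoc (hf : G.IsPathSeq k f) {w : V} (hadj : G.Adj (f (k - 1)) w)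
    (hw : ∀ a < k, f a ≠ w) : G.IsPathSeq (k + 1) fun t => if t < k then f t else w where
  inj a b ha hb h := by
    split_ifs at h with h₁ h₂ h₂
    · exact hf.inj a b h₁ h₂ h
    · exact absurd h (hw a h₁)
    · exact absurd h.symm (hw b h₂)
    · omega
  adj a ha := by
    rcases Nat.lt_or_ge (a + 1) k with h | h
    · rw [if_pos (by omega), if_pos h]
      exact hf.adj a h
    · rw [if_pos (by omega), if_neg (by omega)]
      rwa [show a = k - 1 by omega]

/-- A path with crossing end chords closes up to a cycle on the same vertices. -/
theorem IsPathSeq.exists_isCyclicSeq (hf : G.IsPathSeq k f) {a : ℕ} (ha : a + 1 < k)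
    (h₁ : G.Adj (f (k - 1)) (f a)) (h₂ : G.Adj (f 0) (f (a + 1))) :
    ∃ v, G.IsCyclicSeq k v := by
  have hk : 0 < k := by omega
  refine ⟨fun t => f (if t % k ≤ a then t % k else k + a - t % k), fun t => by simp, ?_, ?_⟩
  · intro b c h
    have hb := Nat.mod_lt b hk
    have hc := Nat.mod_lt c hk
    have := hf.inj _ _ (by split_ifs <;> omega) (by split_ifs <;> omega) h
    rw [Nat.ModEq]
    split_ifs at this <;> omega
  · intro t
    have ht := Nat.mod_lt t hk
    have hsucc : ∀ b c, b < k → c < k → b + 1 = c ∨ c + 1 = b → G.Adj (f b) (f c) := by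
      rintro b c hb hc (rfl | rfl)
      · exact hf.adj b hc
      · exact (hf.adj c hb).symm
    rw [Nat.add_mod_eq_ite, Nat.mod_eq_of_lt (a := 1) (by omega)]
    generalize t % k = r at ht
    by_cases hr : r = k - 1
    · rw [if_pos (by omega : k ≤ r + 1), if_neg (by omega), if_pos (by omega)]
      convert h₂.symm using 2 <;> omega
    · rw [if_neg (by omega : ¬ k ≤ r + 1)]
      by_cases hra : r = a
      · rw [if_pos (by omega), if_neg (by omega)]
        convert h₁.symm using 2
        omega
      · apply hsucc <;> split_ifs <;> omega

theorem IsCyclicSeq.isPathSeq_cons {v : ℕ → V} (hv : G.IsCyclicSeq k v) {w : V} (j : ℕ)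
    (hadj : G.Adj w (v j)) (hw : ∀ a, v a ≠ w) :
    G.IsPathSeq (k + 1) fun t => if t = 0 then w else v (j + t - 1) where
  inj a b ha hb h := by
    split_ifs at h with h₁ h₂ h₂
    · omega
    · exact absurd h.symm (hw _)
    · exact absurd h (hw _)
    · have := hv.eq_of_mem_window j h (by omega) (by omega) (by omega) (by omega)
      omega
  adj a ha := by
    rcases Nat.eq_zero_or_pos a with rfl | h
    · simpa using hadj
    · rw [if_neg (by omega), if_neg (by omega)]
      exact hv.adj_of_succ_eq (by omega)

variable [Fintype V]

theorem IsPathSeq.le_card (hf : G.IsPathSeq k f) : k ≤ Fintype.card V := by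
  simpa using Fintype.card_le_of_injective (fun a : Fin k => f a)
    fun a b h => Fin.ext (hf.inj a b a.2 b.2 h)

variable [DecidableRel G.Adj]

/-- In a longest path, every neighbour of the last vertex lies on the path. -/
theorem IsPathSeq.degree_le_of_maximal (hf : G.IsPathSeq k f)
    (hmax : ∀ g, ¬ G.IsPathSeq (k + 1) g) :
    G.degree (f (k - 1)) ≤ {a ∈ Finset.range (k - 1) | G.Adj (f (k - 1)) (f a)}.card := by
  classical
  rw [← G.card_neighborFinset_eq_degree]
  refine (Finset.card_le_card fun w hw => ?_).trans (Finset.card_image_le (f := f))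
  rw [mem_neighborFinset] at hw
  by_contra hcon
  refine hmax _ (hf.snoc hw fun a ha haw => hcon ?_)
  subst haw
  refine Finset.mem_image_of_mem _ (Finset.mem_filter.2 ⟨Finset.mem_range.2 ?_, hw⟩)
  have : a ≠ k - 1 := by
    rintro rfl
    exact hw.ne rfl
  omega

/-- Dirac's theorem. -/
theorem exists_isCyclicSeq_card (h3 : 3 ≤ Fintype.card V)
    (hd : ∀ x, Fintype.card V ≤ 2 * G.degree x) : ∃ v, G.IsCyclicSeq (Fintype.card V) v := by
  classical
  obtain ⟨x⟩ : Nonempty V := Fintype.card_pos_iff.1 (by omega)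
  have h1 : ∃ f, G.IsPathSeq 1 f :=
    ⟨fun _ => x, fun a b ha hb _ => by omega, fun a ha => by omega⟩
  obtain ⟨k, ⟨hk1, f, hf⟩, hmax⟩ : ∃ k, (1 ≤ k ∧ ∃ f, G.IsPathSeq k f) ∧
      ∀ g, ¬ G.IsPathSeq (k + 1) g := by
    have hspec := Nat.findGreatest_spec (P := fun k => ∃ f, G.IsPathSeq k f)
      (show 1 ≤ Fintype.card V by omega) h1
    have hle := Nat.le_findGreatest (P := fun k => ∃ f, G.IsPathSeq k f)
      (show 1 ≤ Fintype.card V by omega) h1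
    refine ⟨_, ⟨hle, hspec⟩, fun g hg => ?_⟩
    have := Nat.le_findGreatest (P := fun k => ∃ f, G.IsPathSeq k f) hg.le_card ⟨g, hg⟩
    omega
  have hA := hf.degree_le_of_maximal hmax
  have hB := hf.reverse.degree_le_of_maximal hmax
  rw [Nat.sub_self] at hB
  set A := {a ∈ Finset.range (k - 1) | G.Adj (f (k - 1)) (f a)} with hAdef
  set B := {a ∈ Finset.range (k - 1) | G.Adj (f 0) (f (k - 1 - a))} with hBdef
  have hAk : A.card ≤ k - 1 := by simpa using Finset.card_filter_le (Finset.range (k - 1)) _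
  have hkn := hf.le_card
  have hd₀ := hd (f 0)
  have hd₁ := hd (f (k - 1))
  obtain ⟨v, hv⟩ : ∃ v, G.IsCyclicSeq k v := by
    by_contra hcon
    have hdisj : Disjoint A (B.image fun a => k - 1 - a - 1) := by
      rw [Finset.disjoint_left]
      intro a ha ha'
      obtain ⟨b, hb, rfl⟩ := Finset.mem_image.1 ha'
      simp only [hAdef, hBdef, Finset.mem_filter, Finset.mem_range] at ha hb
      refine hcon (hf.exists_isCyclicSeq (a := k - 1 - b - 1) (by omega) ha.2 ?_)
      rw [show k - 1 - b - 1 + 1 = k - 1 - b by omega]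
      exact hb.2
    have hcard : (B.image fun a => k - 1 - a - 1).card = B.card := by
      refine Finset.card_image_of_injOn fun a ha b hb h => ?_
      simp only [hBdef, Finset.coe_filter, Finset.mem_range, Set.mem_ofPred_eq] at ha hb
      omega
    have hsub : A ∪ B.image (fun a => k - 1 - a - 1) ⊆ Finset.range (k - 1) := by
      intro a ha
      rcases Finset.mem_union.1 ha with ha | ha
      · exact (Finset.mem_filter.1 ha).1
      · obtain ⟨b, hb, rfl⟩ := Finset.mem_image.1 ha
        have := Finset.mem_range.1 (Finset.mem_filter.1 hb).1
        exact Finset.mem_range.2 (by omega)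
    have := Finset.card_le_card hsub
    rw [Finset.card_union_of_disjoint hdisj, hcard, Finset.card_range] at this
    omega
  rcases hkn.eq_or_lt with rfl | hlt
  · exact ⟨v, hv⟩
  exfalso
  have hScard : ((Finset.range k).image v).card = k := by
    rw [Finset.card_image_of_injOn, Finset.card_range]
    intro a ha b hb h
    simp only [Finset.coe_range, Set.mem_Iio] at ha hb
    exact hv.eq_of_mem_window 0 h (by omega) (by omega) (by omega) (by omega)
  obtain ⟨w, hw⟩ : ∃ w, w ∉ (Finset.range k).image v := by
    by_contra! hcon
    rw [Finset.eq_univ_iff_forall.2 hcon, Finset.card_univ] at hScard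
    omega
  have hw' : ∀ a, v a ≠ w := by
    rintro a rfl
    refine hw (Finset.mem_image.2 ⟨a % k, Finset.mem_range.2 (Nat.mod_lt _ (by omega)), ?_⟩)
    conv_rhs => rw [← Nat.mod_add_div' a k]
    exact (hv.periodic_mul _ _).symm
  have hsub : G.neighborFinset w ⊆ (insert w ((Finset.range k).image v))ᶜ := by
    intro y hy
    rw [mem_neighborFinset] at hy
    rw [Finset.mem_compl, Finset.mem_insert, Finset.mem_image]
    rintro (rfl | ⟨j, -, rfl⟩)
    · exact hy.ne rfl
    · exact hmax _ (hv.isPathSeq_cons j hy hw')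
  have := Finset.card_le_card hsub
  rw [Finset.card_compl, Finset.card_insert_of_notMem hw, hScard,
    G.card_neighborFinset_eq_degree] at this
  have := hd w
  omega

end Dirac

section Bondy

variable [Fintype V] {v : ℕ → V} {s : ℕ}

namespace IsCyclicSeq

theorem exists_eq_add (hv : G.IsCyclicSeq (Fintype.card V) v) (i : ℕ) (y : V) :
    ∃ x < Fintype.card V, v (i + x) = y := by
  classical
  have hinj : Function.Injective fun x : Fin (Fintype.card V) => v (i + x) := fun a b h =>
    Fin.ext (by
      have := hv.eq_of_mem_window i h (by omega) (by omega) (by omega) (by omega)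
      omega)
  obtain ⟨x, hx⟩ := ((Fintype.bijective_iff_injective_and_card _).2
    ⟨hinj, by simp⟩).surjective y
  exact ⟨x, x.2, hx⟩

variable [DecidableRel G.Adj]

theorem degree_le (hv : G.IsCyclicSeq (Fintype.card V) v) (i : ℕ) :
    G.degree (v i) ≤
      {x ∈ Finset.Icc 1 (Fintype.card V - 1) | G.Adj (v i) (v (i + x))}.card := by
  classical
  rw [← G.card_neighborFinset_eq_degree]
  refine (Finset.card_le_card fun y hy => ?_).trans
    (Finset.card_image_le (f := fun x => v (i + x)))
  rw [mem_neighborFinset] at hy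
  obtain ⟨x, hx, rfl⟩ := hv.exists_eq_add i y
  have h0 : x ≠ 0 := by
    rintro rfl
    exact hy.ne rfl
  exact Finset.mem_image_of_mem _
    (Finset.mem_filter.2 ⟨Finset.mem_Icc.2 ⟨by omega, by omega⟩, hy⟩)

/-- If there is no cycle of length `s + 2`, then the chords at consecutive vertices pair up, and
the degrees are as small as possible. -/
theorem degree_add_degree_add_card_le (hv : G.IsCyclicSeq (Fintype.card V) v) (hs : 1 ≤ s)
    (hsn : s + 3 ≤ Fintype.card V) (hno : ¬ G.HasCycle (s + 2)) (i : ℕ) :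
    G.degree (v i) + G.degree (v (i + 1)) +
      {x ∈ Finset.Icc 2 (Fintype.card V - 1) | ¬ G.Adj (v i) (v (i + x)) ∧
        ¬ G.Adj (v (i + 1)) (v (i + 1 + chordShift (Fintype.card V) s x))}.card ≤
      Fintype.card V := by
  classical
  have hA := hv.degree_le i
  have hB := hv.degree_le (i + 1)
  set n := Fintype.card V
  set A := {x ∈ Finset.Icc 2 (n - 1) | G.Adj (v i) (v (i + x))}
  set B := {x ∈ Finset.Icc 2 (n - 1) | G.Adj (v (i + 1)) (v (i + 1 + chordShift n s x))}
  set C := {x ∈ Finset.Icc 2 (n - 1) | ¬ G.Adj (v i) (v (i + x)) ∧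
        ¬ G.Adj (v (i + 1)) (v (i + 1 + chordShift n s x))}
  have hA' : G.degree (v i) ≤ A.card + 1 := by
    refine hA.trans ((Finset.card_le_card fun x hx => ?_).trans (Finset.card_insert_le 1 A))
    rw [Finset.mem_filter, Finset.mem_Icc] at hx
    rw [Finset.mem_insert, Finset.mem_filter, Finset.mem_Icc]
    rcases Nat.eq_or_lt_of_le hx.1.1 with h | h
    · exact .inl h.symm
    · exact .inr ⟨⟨h, hx.1.2⟩, hx.2⟩
  have hB' : G.degree (v (i + 1)) ≤ B.card + 1 := by
    refine hB.trans ((Finset.card_le_card fun y hy => ?_).trans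
      ((Finset.card_insert_le (n - 1) (B.image (chordShift n s))).trans
        (Nat.add_le_add_right Finset.card_image_le 1)))
    rw [Finset.mem_filter, Finset.mem_Icc] at hy
    rw [Finset.mem_insert]
    by_cases h : y = n - 1
    · exact .inl h
    right
    obtain ⟨x, hx, rfl⟩ : ∃ x ∈ Finset.Icc 2 (n - 1), chordShift n s x = y := by
      simp only [chordShift, Finset.mem_Icc]
      by_cases hys : y + s < n
      · exact ⟨y + s, by omega, by rw [if_pos (by omega)]; omega⟩
      · exact ⟨y + s - (n - 2), by omega, by rw [if_neg (by omega)]; omega⟩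
    exact Finset.mem_image_of_mem _ (Finset.mem_filter.2 ⟨hx, hy.2⟩)
  have hAB : Disjoint A B := by
    rw [Finset.disjoint_left]
    intro x hx hx'
    rw [Finset.mem_filter, Finset.mem_Icc] at hx hx'
    exact hno (hv.hasCycle_of_chordShift hs hsn hx.1.1 (by omega) hx.2 hx'.2)
  have hABC : Disjoint (A ∪ B) C := by
    rw [Finset.disjoint_left]
    intro x hx hx'
    rw [Finset.mem_union, Finset.mem_filter, Finset.mem_filter] at hx
    rw [Finset.mem_filter] at hx'
    tauto
  have hsub : A ∪ B ∪ C ⊆ Finset.Icc 2 (n - 1) :=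
    Finset.union_subset (Finset.union_subset (Finset.filter_subset _ _)
      (Finset.filter_subset _ _)) (Finset.filter_subset _ _)
  have := Finset.card_le_card hsub
  rw [Finset.card_union_of_disjoint hABC, Finset.card_union_of_disjoint hAB, Nat.card_Icc] at this
  omega

/-- If there is no cycle of length `s + 2`, the Hamiltonian cycle has no chord of even length. -/
theorem not_adj_of_even (hv : G.IsCyclicSeq (Fintype.card V) v)
    (hd : ∀ x, Fintype.card V ≤ 2 * G.degree x) (hs : 1 ≤ s) (hsn : s + 3 ≤ Fintype.card V)
    (hno : ¬ G.HasCycle (s + 2)) :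
    Even (Fintype.card V) ∧
      ∀ i m, 1 ≤ m → 2 * m < Fintype.card V → ¬ G.Adj (v i) (v (i + 2 * m)) := by
  have hdeg := hv.degree_add_degree_add_card_le hs hsn hno
  have hpair : ∀ i x, 2 ≤ x → x < Fintype.card V → G.Adj (v i) (v (i + x)) ∨
      G.Adj (v (i + 1)) (v (i + 1 + chordShift (Fintype.card V) s x)) := by
    intro i x hx hxn
    by_contra! hcon
    have hi := hdeg i
    have hpos : 0 < {x ∈ Finset.Icc 2 (Fintype.card V - 1) | ¬ G.Adj (v i) (v (i + x)) ∧
        ¬ G.Adj (v (i + 1)) (v (i + 1 + chordShift (Fintype.card V) s x))}.card :=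
      Finset.card_pos.2 ⟨x, Finset.mem_filter.2
        ⟨Finset.mem_Icc.2 ⟨hx, Nat.le_sub_one_of_lt hxn⟩, hcon⟩⟩
    have := hd (v i)
    have := hd (v (i + 1))
    omega
  have heven : Even (Fintype.card V) := by
    have := hdeg 0
    have := hd (v 0)
    have := hd (v (0 + 1))
    exact Nat.even_iff.2 (by omega)
  set n := Fintype.card V
  unfold chordShift at hpair
  have hcross : ∀ i d, 2 ≤ d → d ≤ s + 2 → G.Adj (v i) (v (i + d)) →
      ¬ G.Adj (v (i + 2)) (v (i + d + (n - 2 - s))) := fun i d hd₂ hds h₁ h₂ =>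
    hno (hv.hasCycle_of_crossing (p := 2) hs (by omega) hd₂ (by omega) (by omega) (by omega) h₁ h₂)
  -- Chords of length two propagate around the cycle.
  have hstep : ∀ i, G.Adj (v (i + 1)) (v (i + 1 + 2)) → G.Adj (v i) (v (i + 2)) := by
    intro i h
    have h₁ := hcross (i + 1) 2 le_rfl (by omega) h
    have h₂ := hpair (i + 2) (n - 2) (by omega) (by omega)
    rw [if_pos (by omega), show i + 2 + 1 + (n - 2 - s) = i + 1 + 2 + (n - 2 - s) by omega] at h₂
    have h₃ := h₂.resolve_right h₁
    rw [show i + 2 + (n - 2) = i + n by omega, hv.periodic] at h₃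
    exact h₃.symm
  have htwo : ∀ i, ¬ G.Adj (v i) (v (i + 2)) := by
    intro i h
    refine hno (hv.hasCycle_of_adj_add_two (fun j => ?_) (by omega) (by omega))
    have hdown : ∀ k, G.Adj (v (j + k)) (v (j + k + 2)) → G.Adj (v j) (v (j + 2)) := by
      intro k
      induction k with
      | zero => exact id
      | succ k ih => exact fun h => ih (hstep _ h)
    refine hdown (i + j * n - j) ?_
    have : j ≤ j * n := Nat.le_mul_of_pos_right j (by omega)
    rw [show j + (i + j * n - j) = i + j * n by omega,
      show i + j * n + 2 = i + 2 + j * n by omega, hv.periodic_mul, hv.periodic_mul]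
    exact h
  have hlow : ∀ m, 1 ≤ m → 2 * m ≤ s + 2 → ∀ i, ¬ G.Adj (v i) (v (i + 2 * m)) := by
    intro m hm
    induction m, hm using Nat.le_induction with
    | base => exact fun _ => htwo
    | succ m hm ih =>
      intro hms i h
      have h₁ := hcross i _ (by omega) hms h
      have h₂ := hpair (i + 1) (2 * m) (by omega) (by omega)
      rw [if_neg (by omega), show i + 1 + 1 = i + 2 by omega,
        show i + 2 + (2 * m + (n - 2 - s)) = i + 2 * (m + 1) + (n - 2 - s) by omega] at h₂
      exact ih (by omega) _ (h₂.resolve_right h₁)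
  have hhigh : ∀ m, 1 ≤ m → 2 * m + s ≤ n → ∀ i, ¬ G.Adj (v i) (v (i + 2 * m)) := by
    intro m hm
    induction m, hm using Nat.le_induction with
    | base => exact fun _ => htwo
    | succ m hm ih =>
      intro hms i h
      have h₁ : ¬ G.Adj (v (i + 1)) (v (i + 1 + (2 * m + s))) := fun h' =>
        hno (hv.hasCycle_of_noncrossing hs (.inr ⟨rfl, rfl⟩) (by omega) (by omega) (by omega) h h')
      have h₂ := (hpair (i + 1) (2 * m + s) (by omega) (by omega)).resolve_left h₁
      rw [if_pos (by omega), Nat.add_sub_cancel] at h₂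
      exact ih (by omega) _ h₂
  have hhalf : ∀ m, 1 ≤ m → 2 * (2 * m) ≤ n → ∀ i, ¬ G.Adj (v i) (v (i + 2 * m)) := by
    intro m hm hmn
    by_cases h : 2 * m ≤ s + 2
    · exact hlow m hm h
    · exact hhigh m hm (by omega)
  refine ⟨heven, fun i m hm hmn h => ?_⟩
  by_cases hle : 2 * (2 * m) ≤ n
  · exact hhalf m hm hle i h
  · obtain ⟨r, hr⟩ := heven
    refine hhalf (r - m) (by omega) (by omega) (i + 2 * m) ?_
    rw [show i + 2 * m + 2 * (r - m) = i + n by omega, hv.periodic]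
    exact h.symm

/-- A graph of minimum degree at least `v(G) / 2` with a Hamiltonian cycle all of whose chords
have odd length is complete bipartite. -/
theorem nonempty_iso_completeBipartiteGraph (hv : G.IsCyclicSeq (Fintype.card V) v)
    (hd : ∀ x, Fintype.card V ≤ 2 * G.degree x) (heven : Even (Fintype.card V))
    (hodd : ∀ i m, 1 ≤ m → 2 * m < Fintype.card V → ¬ G.Adj (v i) (v (i + 2 * m))) :
    Nonempty (G ≃g completeBipartiteGraph
      (Fin (Fintype.card V / 2)) (Fin (Fintype.card V / 2))) := by
  classical
  have hn := Nat.even_iff.1 heven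
  set n := Fintype.card V with hndef
  let φ : Fin (n / 2) ⊕ Fin (n / 2) → V := Sum.elim (fun a => v (2 * a)) fun a => v (2 * a + 1)
  have hinj : Function.Injective φ := by
    rintro (a | a) (b | b) h <;>
    · have := hv.eq_of_mem_window 0 h (by omega) (by omega) (by omega) (by omega)
      first
      | omega
      | exact congrArg _ (Fin.ext (by omega))
  have hbij : Function.Bijective φ :=
    (Fintype.bijective_iff_injective_and_card _).2 ⟨hinj, by simp; omega⟩
  have hsame : ∀ a b, a < n → b < n → a % 2 = b % 2 → ¬ G.Adj (v a) (v b) := by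
    intro a b ha hb hab
    wlog hle : a ≤ b generalizing a b
    · exact fun h => this b a hb ha hab.symm (by omega) h.symm
    intro h
    rcases hle.eq_or_lt with rfl | hlt
    · exact h.ne rfl
    · refine hodd a ((b - a) / 2) (by omega) (by omega) ?_
      rwa [show a + 2 * ((b - a) / 2) = b by omega]
  have hll : ∀ a b, ¬ G.Adj (φ (.inl a)) (φ (.inl b)) := fun a b =>
    hsame _ _ (by omega) (by omega) (by omega)
  have hrr : ∀ a b, ¬ G.Adj (φ (.inr a)) (φ (.inr b)) := fun a b =>
    hsame _ _ (by omega) (by omega) (by omega)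
  have hlr : ∀ a b, G.Adj (φ (.inl a)) (φ (.inr b)) := by
    intro a b
    have hsub : G.neighborFinset (φ (.inl a)) ⊆ Finset.univ.image fun b => φ (.inr b) := by
      intro y hy
      rw [mem_neighborFinset] at hy
      obtain ⟨(c | c), rfl⟩ := hbij.surjective y
      · exact absurd hy (hll a c)
      · exact Finset.mem_image_of_mem _ (Finset.mem_univ c)
    have heq := Finset.eq_of_subset_of_card_le hsub (by
      refine Finset.card_image_le.trans ?_
      rw [Finset.card_univ, Fintype.card_fin, G.card_neighborFinset_eq_degree]
      have := hd (φ (.inl a))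
      omega)
    rw [← mem_neighborFinset, heq]
    exact Finset.mem_image_of_mem _ (Finset.mem_univ b)
  refine ⟨Iso.symm ⟨Equiv.ofBijective φ hbij, ?_⟩⟩
  rintro (a | a) (b | b)
  · simpa using hll a b
  · simpa using hlr a b
  · simpa using (hlr b a).symm
  · simpa using hrr a b

end IsCyclicSeq

end Bondy

end SimpleGraph

/-- Bondy's theorem: any graph on at least 3 vertices with minimum degree at least `v(G)/2`
is either isomorphic to the complete bipartite graph `K_{v/2,v/2}` or is pancyclic,
containing cycles of every length `3 ≤ ℓ ≤ v(G)`. -/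
theorem stmt12 {V : Type*} [Fintype V] [DecidableEq V] (G : SimpleGraph V) [DecidableRel G.Adj]
    (h3 : 3 ≤ Fintype.card V) (hδ : (Fintype.card V : ℝ) / 2 ≤ (G.minDegree : ℝ)) :
    Nonempty (G ≃g completeBipartiteGraph
        (Fin (Fintype.card V / 2)) (Fin (Fintype.card V / 2))) ∨
    ∀ ℓ : ℕ, 3 ≤ ℓ → ℓ ≤ Fintype.card V →
      ∃ (x : V) (w : G.Walk x x), w.IsCycle ∧ w.length = ℓ := by
  have hd : ∀ x, Fintype.card V ≤ 2 * G.degree x := by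
    intro x
    have h : (Fintype.card V : ℝ) ≤ 2 * G.minDegree := by linarith
    have h : Fintype.card V ≤ 2 * G.minDegree := by exact_mod_cast h
    have := G.minDegree_le_degree x
    omega
  obtain ⟨v, hv⟩ := SimpleGraph.exists_isCyclicSeq_card h3 hd
  by_contra! hcon
  obtain ⟨hiso, ℓ, hℓ, hℓn, hno⟩ := hcon
  have hno : ¬ G.HasCycle ℓ := fun ⟨x, w, hw, hl⟩ => hno x w hw hl
  rcases hℓn.eq_or_lt with rfl | hlt
  · refine hno (hv.hasCycle_of_positions 0 h3 id (fun t ht => ⟨by simp, by simpa using ht⟩)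
      (fun _ _ _ _ => id) (fun t _ => hv.adj t) ?_)
    have h := hv.adj (Fintype.card V - 1)
    rwa [show Fintype.card V - 1 + 1 = 0 + Fintype.card V by omega, hv.periodic] at h
  · obtain ⟨s, rfl⟩ : ∃ s, ℓ = s + 2 := ⟨ℓ - 2, by omega⟩
    obtain ⟨heven, hodd⟩ := hv.not_adj_of_even hd (by omega) (by omega) hno
    obtain ⟨e⟩ := hv.nonempty_iso_completeBipartiteGraph hd heven hodd
    exact hiso.elim e
end

section
/- Let H be a graph with vertex partition V(H) = U ∪ V, where every vertex of the induced graph H[V] has at least 0.9·|V| neighbours in V, and |U| ≤ 0.1·|V|. Suppose U is the vertex-disjoint union of paths P₁,…,P_m in H, each of length at most 2, and there exist distinct vertices a₁,…,a_m,b₁,…,b_m ∈ V such that a_i is adjacent to one endpoint of P_i and b_i to the other endpoint. Then H is pancyclic: it contains a cycle of every length ℓ with 3 ≤ ℓ ≤ v(H). -/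
/-- If `t` has fewer non-neighbours on a chain than the chain has gaps, then `t` can be inserted
into one of the gaps. -/
theorem List.IsChain.exists_insert {T : Type*} {R : T → T → Prop} [DecidableRel R] (t c : T) :
    ∀ (l : List T) (a : T), (a :: (l ++ [c])).IsChain R →
      (a :: l).countP (fun s => ¬ R s t) + (l ++ [c]).countP (fun s => ¬ R t s) < l.length + 1 →
      ∃ l' : List T, l'.Perm (t :: l) ∧ (a :: (l' ++ [c])).IsChain R := by
  intro l
  induction l with
  | nil =>
    intro a _ hcount
    refine ⟨[t], List.Perm.refl _, ?_⟩
    by_cases h1 : R a t <;> by_cases h2 : R t c <;> simp_all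
  | cons b l ih =>
    intro a hchain hcount
    simp only [List.cons_append, List.isChain_cons_cons] at hchain
    by_cases hgap : R a t ∧ R t b
    · exact ⟨t :: b :: l, List.Perm.refl _, by simpa using ⟨hgap.1, hgap.2, hchain.2⟩⟩
    · obtain ⟨l', hperm, hl'⟩ := ih b hchain.2 (by
        simp only [List.cons_append, List.countP_cons, List.length_cons] at hcount ⊢
        by_cases h1 : R a t <;> by_cases h2 : R t b <;> simp_all <;> omega)
      refine ⟨b :: l', (hperm.cons b).trans (List.Perm.swap t b l), ?_⟩
      simpa using ⟨hchain.1, by simpa using hl'⟩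

theorem List.Nodup.countP_le_card_filter {T : Type*} [DecidableEq T] {S : Finset T} {l : List T}
    (hl : l.Nodup) (hS : ∀ s ∈ l, s ∈ S) (P : T → Prop) [DecidablePred P] :
    l.countP P ≤ (S.filter P).card := by
  rw [List.countP_eq_length_filter, ← List.toFinset_card_of_nodup (hl.filter _)]
  refine Finset.card_le_card fun s hs => ?_
  simp only [List.mem_toFinset, List.mem_filter, decide_eq_true_eq] at hs
  exact Finset.mem_filter.2 ⟨hS s hs.1, hs.2⟩

/-- A closed chain `a, l, a` through distinct elements of `S`: a directed cycle of `R` in `S`. -/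
structure IsClosedChain {T : Type*} (R : T → T → Prop) (S : Finset T) (a : T) (l : List T) :
    Prop where
  isChain : (a :: (l ++ [a])).IsChain R
  nodup : (a :: l).Nodup
  mem : ∀ s ∈ a :: l, s ∈ S

section Dense

variable {T : Type*} [DecidableEq T] {R : T → T → Prop} [DecidableRel R] {S : Finset T} {d : ℕ}

/-- In a dense relation, any two elements are joined by a path of length two avoiding a given
small list. -/
theorem exists_common_neighbor_not_mem
    (hout : ∀ s ∈ S, (S.filter (fun t => ¬ R s t)).card ≤ d)
    (hin : ∀ t ∈ S, (S.filter (fun s => ¬ R s t)).card ≤ d)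
    {u w : T} (hu : u ∈ S) (hw : w ∈ S) (l : List T) (hl : l.length + 2 * d < S.card) :
    ∃ t ∈ S, t ∉ l ∧ R u t ∧ R t w := by
  by_contra! hno
  have hsub : S ⊆ l.toFinset ∪ (S.filter (fun t => ¬ R u t) ∪ S.filter (fun t => ¬ R t w)) := by
    intro t ht
    have := hno t ht
    simp only [Finset.mem_union, Finset.mem_filter, List.mem_toFinset]
    tauto
  have h1 := Finset.card_le_card hsub
  have h2 := Finset.card_union_le l.toFinset
    (S.filter (fun t => ¬ R u t) ∪ S.filter (fun t => ¬ R t w))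
  have h3 := Finset.card_union_le (S.filter (fun t => ¬ R u t)) (S.filter (fun t => ¬ R t w))
  have h4 := List.toFinset_card_le l
  have h5 := hout u hu
  have h6 := hin w hw
  omega

theorem IsClosedChain.exists_extension
    (hout : ∀ s ∈ S, (S.filter (fun t => ¬ R s t)).card ≤ d)
    (hin : ∀ t ∈ S, (S.filter (fun s => ¬ R s t)).card ≤ d) (hd : 4 * d < S.card)
    {a : T} {l : List T} (h : IsClosedChain R S a l) (hlt : l.length + 1 < S.card) :
    ∃ l', IsClosedChain R S a l' ∧ l'.length = l.length + 1 := by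
  suffices ∃ t ∈ S, t ∉ a :: l ∧ ∃ l' : List T, l'.Perm (t :: l) ∧ (a :: (l' ++ [a])).IsChain R by
    obtain ⟨t, htS, htl, l', hperm, hchain⟩ := this
    have hperm' : (a :: l').Perm (t :: a :: l) := (hperm.cons a).trans (List.Perm.swap t a l)
    refine ⟨l', ⟨hchain, hperm'.nodup_iff.2 (List.nodup_cons.2 ⟨htl, h.nodup⟩), fun s hs => ?_⟩,
      by simpa using hperm.length_eq⟩
    rcases List.mem_cons.1 (hperm'.mem_iff.1 hs) with rfl | hs
    · exact htS
    · exact h.mem s hs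
  have haS : a ∈ S := h.mem a List.mem_cons_self
  by_cases hsmall : l.length + 1 + 2 * d < S.card
  · obtain ⟨w, l₁, hw⟩ : ∃ w l₁, l ++ [a] = w :: l₁ := by cases l <;> simp
    have hwS : w ∈ S := by
      have : w ∈ l ++ [a] := by simp [hw]
      exact h.mem w (by simpa [or_comm] using this)
    obtain ⟨t, htS, htl, h1, h2⟩ :=
      exists_common_neighbor_not_mem hout hin haS hwS (a :: l) (by simpa using hsmall)
    refine ⟨t, htS, htl, t :: l, List.Perm.refl _, ?_⟩
    have hchain := h.isChain
    rw [hw, List.isChain_cons_cons] at hchain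
    rw [List.cons_append, hw]
    simpa using ⟨h1, h2, hchain.2⟩
  · obtain ⟨t, htS, htl⟩ : ∃ t ∈ S, t ∉ (a :: l).toFinset := by
      apply Finset.exists_mem_notMem_of_card_lt_card
      rw [List.toFinset_card_of_nodup h.nodup]
      simpa using hlt
    refine ⟨t, htS, by simpa using htl, List.IsChain.exists_insert t a l a h.isChain ?_⟩
    have hperm : (l ++ [a]).Perm (a :: l) := List.perm_append_singleton a l
    rw [hperm.countP_eq]
    have h1 := h.nodup.countP_le_card_filter h.mem (fun s => ¬ R s t)
    have h2 := h.nodup.countP_le_card_filter h.mem (fun s => ¬ R t s)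
    have h3 := hout t htS
    have h4 := hin t htS
    omega

/-- A dense relation has directed cycles of all lengths from `2` on. -/
theorem exists_isClosedChain_of_dense
    (hout : ∀ s ∈ S, (S.filter (fun t => ¬ R s t)).card ≤ d)
    (hin : ∀ t ∈ S, (S.filter (fun s => ¬ R s t)).card ≤ d) (hd : 4 * d < S.card)
    (k : ℕ) (hk : 2 ≤ k) (hkS : k ≤ S.card) :
    ∃ a l, IsClosedChain R S a l ∧ l.length + 1 = k := by
  induction k, hk using Nat.le_induction with
  | base =>
    obtain ⟨a, ha⟩ : S.Nonempty := Finset.card_pos.1 (by omega)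
    obtain ⟨t, htS, hta, h1, h2⟩ :=
      exists_common_neighbor_not_mem hout hin ha ha [a] (by simp; omega)
    have hta' : a ≠ t := by simpa [eq_comm] using hta
    exact ⟨a, [t], ⟨by simp [h1, h2], by simp [hta'], by simp [ha, htS]⟩, rfl⟩
  | succ k _ ih =>
    obtain ⟨a, l, h, hl⟩ := ih (by omega)
    obtain ⟨l', h', hl'⟩ := h.exists_extension hout hin hd (by omega)
    exact ⟨a, l', h', by omega⟩

end Dense

namespace SimpleGraph

theorem Walk.isCycle_of_nodup_support_tail {α : Type*} {H : SimpleGraph α} {v : α} (w : H.Walk v v)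
    (hlen : 3 ≤ w.length) (hw : w.support.tail.Nodup) : w.IsCycle := by
  cases w with
  | nil => simp at hlen
  | cons h p =>
    have hp : p.IsPath := by simpa [Walk.isPath_def] using hw
    refine (Walk.cons_isCycle_iff p h).2 ⟨hp, fun he => ?_⟩
    have := hp.length_eq_one_of_mem_edges (by rwa [Sym2.eq_swap])
    simp only [Walk.length_cons] at hlen
    omega

section Blocks

variable {α T : Type*} {H : SimpleGraph α} {left right : T → α}
  (q : ∀ t, H.Walk (left t) (right t))

/-- A chain of walks, the end of each adjacent to the start of the next, can be concatenated. -/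
theorem Walk.exists_support_eq_flatMap (c : T) :
    ∀ (l : List T) (a : T),
      (a :: (l ++ [c])).IsChain (fun s t => H.Adj (right s) (left t)) →
      ∃ w : H.Walk (left a) (left c),
        w.support = (a :: l).flatMap (fun t => (q t).support) ++ [left c] := by
  intro l
  induction l with
  | nil =>
    intro a h
    exact ⟨(q a).append (.cons (by simpa using h) .nil), by simp [Walk.support_append]⟩
  | cons b l ih =>
    intro a h
    simp only [List.cons_append, List.isChain_cons_cons] at h
    obtain ⟨w, hw⟩ := ih b h.2
    refine ⟨(q a).append (.cons h.1 w), ?_⟩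
    rw [Walk.support_append, Walk.support_cons, List.tail_cons, hw]
    simp

/-- Disjoint paths arranged in a closed chain form a cycle. -/
theorem exists_isCycle_of_isClosedChain [DecidableEq T] {S : Finset T}
    (hpath : ∀ t ∈ S, (q t).IsPath)
    (hdisj : ∀ s ∈ S, ∀ t ∈ S, s ≠ t → List.Disjoint (q s).support (q t).support)
    {a : T} {l : List T}
    (h : IsClosedChain (fun s t => H.Adj (right s) (left t)) S a l)
    (hlen : 3 ≤ ∑ t ∈ (a :: l).toFinset, (q t).support.length) :
    ∃ (v : α) (w : H.Walk v v), w.IsCycle ∧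
      w.length = ∑ t ∈ (a :: l).toFinset, (q t).support.length := by
  obtain ⟨w, hw⟩ := Walk.exists_support_eq_flatMap q a l a h.isChain
  have hlength : w.length = ∑ t ∈ (a :: l).toFinset, (q t).support.length := by
    have := congrArg List.length hw
    rw [Walk.length_support, List.length_append, List.length_flatMap] at this
    rw [List.sum_toFinset _ h.nodup]
    simpa using this
  refine ⟨left a, w, w.isCycle_of_nodup_support_tail (hlength ▸ hlen) ?_, hlength⟩
  have hnodup : ((a :: l).flatMap (fun t => (q t).support)).Nodup := by
    rw [List.nodup_flatMap]
    refine ⟨fun t ht => (hpath t (h.mem t ht)).support_nodup, ?_⟩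
    exact h.nodup.imp_of_mem fun hs ht hne => hdisj _ (h.mem _ hs) _ (h.mem _ ht) hne
  obtain ⟨r, hr⟩ : ∃ r, (a :: l).flatMap (fun t => (q t).support) = left a :: r := by
    refine ⟨(q a).support.tail ++ l.flatMap (fun t => (q t).support), ?_⟩
    rw [List.flatMap_cons, ← List.cons_append, Walk.cons_tail_support]
  rw [hw, hr, List.cons_append, List.tail_cons, (List.perm_append_singleton _ r).nodup_iff, ← hr]
  exact hnodup

end Blocks

end SimpleGraph

namespace SimpleGraph

/-- Disjoint paths whose ends are densely joined: any admissible number of them can be arranged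
in a cycle. -/
theorem exists_isCycle_of_dense_paths {α T : Type*} [DecidableEq T] {H : SimpleGraph α}
    [DecidableRel H.Adj] {left right : T → α} (q : ∀ t, H.Walk (left t) (right t))
    {S : Finset T} {d : ℕ}
    (hout : ∀ s ∈ S, (S.filter (fun t => ¬ H.Adj (right s) (left t))).card ≤ d)
    (hin : ∀ t ∈ S, (S.filter (fun s => ¬ H.Adj (right s) (left t))).card ≤ d)
    (hd : 4 * d < S.card)
    (hpath : ∀ t ∈ S, (q t).IsPath)
    (hdisj : ∀ s ∈ S, ∀ t ∈ S, s ≠ t → List.Disjoint (q s).support (q t).support)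
    (k : ℕ) (hk : 2 ≤ k) (hkS : k ≤ S.card) :
    ∃ Q ⊆ S, Q.card = k ∧ (3 ≤ ∑ t ∈ Q, (q t).support.length →
      ∃ (v : α) (w : H.Walk v v), w.IsCycle ∧ w.length = ∑ t ∈ Q, (q t).support.length) := by
  obtain ⟨a, l, h, hl⟩ := exists_isClosedChain_of_dense
    (R := fun s t => H.Adj (right s) (left t)) hout hin hd k hk hkS
  refine ⟨(a :: l).toFinset, fun t ht => h.mem t (List.mem_toFinset.1 ht), ?_,
    exists_isCycle_of_isClosedChain q hpath hdisj h⟩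
  rw [List.toFinset_card_of_nodup h.nodup, List.length_cons, hl]

end SimpleGraph

theorem Finset.card_filter_comp_le_of_injOn {T α : Type*} {S : Finset T} {V : Finset α} {f : T → α}
    (hf : Set.InjOn f S) (hV : ∀ s ∈ S, f s ∈ V) (P : α → Prop) [DecidablePred P] :
    (S.filter (fun s => P (f s))).card ≤ (V.filter P).card := by
  refine Finset.card_le_card_of_injOn f (fun s hs => ?_)
    (hf.mono (Finset.coe_subset.2 (Finset.filter_subset _ _)))
  have hs := Finset.mem_filter.1 hs
  exact Finset.mem_filter.2 ⟨hV s hs.1, hs.2⟩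


/-- Absorption lemma (pancyclicity): let `H` have vertex partition `U ∪ V` with every vertex
of `H[V]` having at least `0.9|V|` neighbours in `V` and `|U| ≤ 0.1|V|`. Suppose `U` is the
vertex-disjoint union of paths `P i` of length at most 2 and there are distinct vertices
`a i, b i ∈ V` with `a i` adjacent to one end of `P i` and `b i` to the other. Then `H` is
pancyclic: it has a cycle of every length `3 ≤ ℓ ≤ v(H)`. -/
theorem stmt13 {α : Type*} [Fintype α] [DecidableEq α] (H : SimpleGraph α) [DecidableRel H.Adj]
    (U V : Finset α) (hUV : Disjoint U V) (hunion : U ∪ V = Finset.univ)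
    (hdeg : ∀ v ∈ V, (0.9 : ℝ) * V.card ≤ ((V.filter (H.Adj v)).card : ℝ))
    (hU : (U.card : ℝ) ≤ (0.1 : ℝ) * V.card)
    (m : ℕ) (x y : Fin m → α) (p : ∀ i, H.Walk (x i) (y i))
    (hpath : ∀ i, (p i).IsPath) (hlen : ∀ i, (p i).length ≤ 2)
    (hsupU : ∀ w : α, w ∈ U ↔ ∃ i, w ∈ (p i).support)
    (hdisj : ∀ i j, i ≠ j → ∀ w, w ∈ (p i).support → w ∉ (p j).support)
    (a b : Fin m → α)
    (haV : ∀ i, a i ∈ V) (hbV : ∀ i, b i ∈ V)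
    (hainj : Function.Injective a) (hbinj : Function.Injective b)
    (hab : ∀ i j, a i ≠ b j)
    (hadja : ∀ i, H.Adj (a i) (x i)) (hadjb : ∀ i, H.Adj (b i) (y i)) :
    ∀ ℓ : ℕ, 3 ≤ ℓ → ℓ ≤ Fintype.card α →
      ∃ (v : α) (w : H.Walk v v), w.IsCycle ∧ w.length = ℓ := by
  intro ℓ hℓ hℓcard
  set n := V.card
  have hcard : Fintype.card α = U.card + n := by
    rw [← Finset.card_univ, ← hunion, Finset.card_union_of_disjoint hUV]
  have hnonadj : ∀ v ∈ V, (V.filter (fun u => ¬ H.Adj v u)).card ≤ n / 10 := by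
    intro v hv
    have h1 := hdeg v hv
    have h2 := Finset.card_filter_add_card_filter_not (s := V) (H.Adj v)
    have h3 : 9 * n ≤ 10 * (V.filter (H.Adj v)).card := by
      have : (9 * n : ℝ) ≤ 10 * (V.filter (H.Adj v)).card := by linarith
      exact_mod_cast this
    omega
  have hU' : U.card ≤ n / 10 := by
    have : 10 * U.card ≤ n := by
      have : (10 * U.card : ℝ) ≤ n := by linarith
      exact_mod_cast this
    omega
  have hn10 : 10 ≤ n := by
    obtain ⟨v, hv⟩ : V.Nonempty := Finset.card_pos.1 (by omega)
    have h1 := hnonadj v hv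
    have h2 : 0 < (V.filter (fun u => ¬ H.Adj v u)).card :=
      Finset.card_pos.2 ⟨v, by simp [hv]⟩
    omega
  have hUsum : ∑ i, (p i).support.length = U.card := by
    have hUeq : U = Finset.univ.biUnion fun i => (p i).support.toFinset := by
      ext w
      simp [hsupU]
    rw [hUeq, Finset.card_biUnion]
    · exact Finset.sum_congr rfl fun i _ =>
        (List.toFinset_card_of_nodup (hpath i).support_nodup).symm
    · intro i _ j _ hij
      exact Finset.disjoint_left.2 fun w hi hj =>
        hdisj i j hij w (List.mem_toFinset.1 hi) (List.mem_toFinset.1 hj)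
  have hm : m ≤ U.card := by
    rw [← hUsum]
    calc m = ∑ _i : Fin m, 1 := by simp
      _ ≤ _ := Finset.sum_le_sum fun i _ => by simp
  have hUnotV : ∀ i, ∀ w ∈ (p i).support, w ∉ V := fun i w hw =>
    Finset.disjoint_left.1 hUV ((hsupU w).2 ⟨i, hw⟩)
  set A := V \ (Finset.univ.image a ∪ Finset.univ.image b) with hA
  have hAmem : ∀ v, v ∈ A ↔ v ∈ V ∧ (∀ i, a i ≠ v) ∧ ∀ i, b i ≠ v := by
    intro v
    simp [hA]
  have hAcard : A.card + 2 * m = n := by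
    have hsub : Finset.univ.image a ∪ Finset.univ.image b ⊆ V := by
      intro v hv
      simp only [Finset.mem_union, Finset.mem_image, Finset.mem_univ, true_and] at hv
      rcases hv with ⟨i, rfl⟩ | ⟨i, rfl⟩
      · exact haV i
      · exact hbV i
    have hdis : Disjoint (Finset.univ.image a) (Finset.univ.image b) := by
      rw [Finset.disjoint_left]
      simp only [Finset.mem_image, Finset.mem_univ, true_and]
      rintro _ ⟨i, rfl⟩ ⟨j, hj⟩
      exact hab i j hj.symm
    have h1 := Finset.card_sdiff_add_card_eq_card hsub
    rw [← hA, Finset.card_union_of_disjoint hdis, Finset.card_image_of_injective _ hainj,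
      Finset.card_image_of_injective _ hbinj, Finset.card_univ, Fintype.card_fin] at h1
    omega
  -- The blocks: single vertices of `A`, and the paths `a i, P i, b i`.
  let left : α ⊕ Fin m → α := Sum.elim id a
  let right : α ⊕ Fin m → α := Sum.elim id b
  let q : ∀ t, H.Walk (left t) (right t) := fun t =>
    match t with
    | .inl _ => .nil
    | .inr i => .cons (hadja i) ((p i).concat (hadjb i).symm)
  have hqinl : ∀ v, (q (.inl v)).support = [v] := fun v => rfl
  have hqinr : ∀ i, (q (.inr i)).support = a i :: ((p i).support ++ [b i]) := fun i => by
    rw [← SimpleGraph.Walk.support_concat (p i) (hadjb i).symm]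
    rfl
  have main : ∀ W ⊆ A, ∀ J : Finset (Fin m), 4 * (n / 10) < W.card + J.card →
      ∀ k, 2 ≤ k → k ≤ W.card + J.card →
      ∃ Q ⊆ W.disjSum J, Q.card = k ∧ (3 ≤ ∑ t ∈ Q, (q t).support.length →
        ∃ (v : α) (w : H.Walk v v), w.IsCycle ∧ w.length = ∑ t ∈ Q, (q t).support.length) := by
    intro W hW J hWJ k hk hkS
    have hWmem := fun v (hv : v ∈ W) => (hAmem v).1 (hW hv)
    have hleftV : ∀ s ∈ W.disjSum J, left s ∈ V := by
      rintro (v | i) hs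
      · exact (hWmem v (by simpa using hs)).1
      · exact haV i
    have hrightV : ∀ s ∈ W.disjSum J, right s ∈ V := by
      rintro (v | i) hs
      · exact (hWmem v (by simpa using hs)).1
      · exact hbV i
    have hleftinj : Set.InjOn left (W.disjSum J) := by
      rintro (v | i) hs (u | j) ht hst
      · exact congrArg _ hst
      · exact absurd hst.symm ((hWmem v (by simpa using hs)).2.1 j)
      · exact absurd hst ((hWmem u (by simpa using ht)).2.1 i)
      · exact congrArg _ (hainj hst)
    have hrightinj : Set.InjOn right (W.disjSum J) := by
      rintro (v | i) hs (u | j) ht hst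
      · exact congrArg _ hst
      · exact absurd hst.symm ((hWmem v (by simpa using hs)).2.2 j)
      · exact absurd hst ((hWmem u (by simpa using ht)).2.2 i)
      · exact congrArg _ (hbinj hst)
    refine SimpleGraph.exists_isCycle_of_dense_paths q (d := n / 10) ?_ ?_ ?_ ?_ ?_ k hk ?_
    · intro s hs
      exact (Finset.card_filter_comp_le_of_injOn hleftinj hleftV
        (fun u => ¬ H.Adj (right s) u)).trans (hnonadj _ (hrightV s hs))
    · intro t ht
      refine le_trans ?_ (hnonadj _ (hleftV t ht))
      simp only [H.adj_comm _ (left t)]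
      exact Finset.card_filter_comp_le_of_injOn hrightinj hrightV (fun u => ¬ H.Adj (left t) u)
    · rwa [Finset.card_disjSum]
    · rintro (v | i) _
      · exact SimpleGraph.Walk.IsPath.nil
      · have h1 : a i ∉ (p i).support := fun h => hUnotV i _ h (haV i)
        have h2 : b i ∉ (p i).support := fun h => hUnotV i _ h (hbV i)
        rw [SimpleGraph.Walk.isPath_def, hqinr, List.nodup_cons,
          (List.perm_append_singleton _ _).nodup_iff, List.nodup_cons]
        exact ⟨by simpa using ⟨h1, hab i i⟩, h2, (hpath i).support_nodup⟩
    · have hsingle : ∀ v ∈ W, ∀ j, v ∉ a j :: ((p j).support ++ [b j]) := by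
        intro v hv j h
        obtain ⟨h1, h2, h3⟩ := hWmem v hv
        simp only [List.mem_cons, List.mem_append, List.not_mem_nil, or_false] at h
        rcases h with h | h | h
        · exact h2 j h.symm
        · exact hUnotV j v h h1
        · exact h3 j h.symm
      rintro (v | i) hs (u | j) ht hst
      · have : v ≠ u := fun h => hst (congrArg _ h)
        simpa [hqinl] using this.symm
      · rw [hqinl, hqinr, List.singleton_disjoint]
        exact hsingle v (by simpa using hs) j
      · rw [hqinl, hqinr, List.disjoint_singleton]
        exact hsingle u (by simpa using ht) i
      · have hij : i ≠ j := fun h => hst (congrArg _ h)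
        rw [hqinr, hqinr]
        intro w hwi hwj
        simp only [List.mem_cons, List.mem_append, List.not_mem_nil, or_false] at hwi hwj
        rcases hwi with rfl | hwi | rfl <;> rcases hwj with h | hwj | h
        · exact hij (hainj h)
        · exact hUnotV j _ hwj (haV i)
        · exact hab i j h
        · exact hUnotV i _ hwi (h ▸ haV j)
        · exact hdisj i j hij w hwi hwj
        · exact hUnotV i _ hwi (h ▸ hbV j)
        · exact hab j i h.symm
        · exact hUnotV j _ hwj (hbV i)
        · exact hij (hbinj h)
    · rwa [Finset.card_disjSum]
  by_cases hsmall : ℓ ≤ A.card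
  · obtain ⟨Q, hQ, hQcard, hcycle⟩ :=
      main A subset_rfl ∅ (by simp; omega) ℓ (by omega) (by simpa using hsmall)
    have hsum : ∑ t ∈ Q, (q t).support.length = ℓ := by
      rw [← hQcard, Finset.card_eq_sum_ones]
      refine Finset.sum_congr rfl fun t ht => ?_
      obtain ⟨v, -, rfl⟩ : ∃ v ∈ A, Sum.inl v = t := by simpa using hQ ht
      rw [hqinl, List.length_singleton]
    rw [hsum] at hcycle
    exact hcycle hℓ
  · obtain ⟨W, hW, hWcard⟩ :=
      Finset.exists_subset_card_eq (s := A) (n := ℓ - U.card - 2 * m) (by omega)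
    have hS : 4 * (n / 10) < W.card + (Finset.univ : Finset (Fin m)).card := by
      rw [hWcard, Finset.card_univ, Fintype.card_fin]
      omega
    obtain ⟨Q, hQ, hQcard, hcycle⟩ := main W hW Finset.univ hS _ (by omega) le_rfl
    have hQeq : Q = W.disjSum Finset.univ :=
      Finset.eq_of_subset_of_card_le hQ (by rw [hQcard, Finset.card_disjSum])
    have hsum : ∑ t ∈ Q, (q t).support.length = ℓ := by
      have hblock : ∀ i, (q (.inr i)).support.length = (p i).support.length + 2 := fun i => by
        rw [hqinr, List.length_cons, List.length_append, List.length_singleton]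
      rw [hQeq, Finset.sum_disjSum, Finset.sum_congr rfl fun i _ => hblock i,
        Finset.sum_congr rfl fun v _ => congrArg List.length (hqinl v), Finset.sum_add_distrib,
        hUsum]
      simp only [List.length_singleton, Finset.sum_const, Finset.card_univ, Fintype.card_fin,
        smul_eq_mul, hWcard]
      clear hcycle
      omega
    rw [hsum] at hcycle
    exact hcycle hℓ
end

section
/- Let G be a graph on N vertices with average degree d(G) ≥ 16·γ·d₁, where γ > 1 and d₁ ≥ 2 are real numbers. Then G contains a cycle of length ℓ for some ℓ with d₁ ≤ ℓ ≤ d₁ + 2·log N / log γ. -/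
namespace SimpleGraph

open Finset

variable {V : Type*}

open Classical in
/-- A vertex set with at least `c * #W` edges inside it contains a nonempty subset in which every
vertex has more than `c` neighbours. -/
theorem exists_subset_forall_lt_card_filter_adj (H : SimpleGraph V) {c : ℝ} (hc : 0 < c)
    {W : Finset V} (hW : W.Nonempty)
    (hsum : 2 * c * #W ≤ ∑ x ∈ W, (#{y ∈ W | H.Adj x y} : ℝ)) :
    ∃ U ⊆ W, U.Nonempty ∧ ∀ x ∈ U, c < #{y ∈ U | H.Adj x y} := by
  induction W using Finset.strongInduction with
  | H W ih =>
    by_cases h : ∀ x ∈ W, c < #{y ∈ W | H.Adj x y}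
    · exact ⟨W, subset_rfl, hW, h⟩
    push Not at h
    obtain ⟨x, hx, hdeg⟩ := h
    have hsplit : ∀ z, (#{y ∈ W | H.Adj z y} : ℝ) =
        #{y ∈ W.erase x | H.Adj z y} + if H.Adj z x then 1 else 0 := by
      intro z
      rw [filter_erase]
      split_ifs with hz
      · rw [card_erase_of_mem (by simp [hx, hz]), Nat.cast_sub]
        · simp
        · exact card_pos.2 ⟨x, by simp [hx, hz]⟩
      · rw [erase_eq_of_notMem (by simp [hz])]
        simp
    have hback : ∑ z ∈ W.erase x, (if H.Adj z x then (1 : ℝ) else 0) = #{y ∈ W | H.Adj x y} := by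
      rw [sum_boole, filter_erase, erase_eq_of_notMem (by simp)]
      simp_rw [H.adj_comm]
    have hsum' : ∑ z ∈ W, (#{y ∈ W | H.Adj z y} : ℝ) =
        ∑ z ∈ W.erase x, (#{y ∈ W.erase x | H.Adj z y} : ℝ) + 2 * #{y ∈ W | H.Adj x y} := by
      rw [← add_sum_erase _ _ hx, sum_congr rfl (fun z _ ↦ hsplit z), sum_add_distrib, hback]
      ring
    have hcard : (#W : ℝ) = #(W.erase x) + 1 := by
      exact_mod_cast (card_erase_add_one hx).symm
    rw [hsum', hcard] at hsum
    have hne : (W.erase x).Nonempty := by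
      rw [nonempty_iff_ne_empty]
      intro he
      have hW1 : W ⊆ {x} := by
        intro y hy
        by_contra hyx
        have : y ∈ W.erase x := mem_erase.2 ⟨by simpa using hyx, hy⟩
        simp [he] at this
      have h0 : #{y ∈ W | H.Adj x y} = 0 := by
        rw [card_eq_zero, filter_eq_empty_iff]
        intro y hy
        rw [mem_singleton.1 (hW1 hy)]
        exact H.irrefl
      rw [he, h0] at hsum
      simp at hsum
      linarith
    obtain ⟨U, hU, h⟩ := ih _ (erase_ssubset hx) hne (by linarith)
    exact ⟨U, hU.trans (erase_subset _ _), h⟩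

open Classical in
/-- If every vertex of `U` has at least `m` neighbours in `U`, then each vertex of `U` starts a path
of length `m` inside `U`. -/
theorem exists_isPath_length_eq (H : SimpleGraph V) {U : Finset V} {m : ℕ}
    (hU : ∀ x ∈ U, m ≤ #{y ∈ U | H.Adj x y}) {x : V} (hx : x ∈ U) :
    ∃ (y : V) (p : H.Walk x y), p.IsPath ∧ p.length = m ∧ ∀ z ∈ p.support, z ∈ U := by
  suffices h : ∀ k ≤ m, ∃ (y : V) (p : H.Walk y x),
      p.IsPath ∧ p.length = k ∧ ∀ z ∈ p.support, z ∈ U by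
    obtain ⟨y, p, hp, hl, hs⟩ := h m le_rfl
    exact ⟨y, p.reverse, hp.reverse, by simpa, by simpa using hs⟩
  intro k
  induction k with
  | zero => exact fun _ ↦ ⟨x, .nil, by simp, rfl, by simpa⟩
  | succ k ih =>
    intro hk
    obtain ⟨y, p, hp, hl, hs⟩ := ih (by omega)
    have hnot : ¬ {z ∈ U | H.Adj y z} ⊆ p.support.toFinset.erase y := by
      intro hsub
      have h1 := card_le_card hsub
      rw [card_erase_of_mem (by simp)] at h1
      have h2 := p.support.toFinset_card_le
      rw [Walk.length_support] at h2
      have h3 := hU y (hs y (by simp))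
      omega
    obtain ⟨z, hz, hzp⟩ := not_subset.1 hnot
    rw [mem_filter] at hz
    have hzs : z ∉ p.support := fun h ↦ hzp (by simp [h, hz.2.ne'])
    refine ⟨z, .cons hz.2.symm p, (Walk.cons_isPath_iff _ _).2 ⟨hp, hzs⟩, by simp [hl], ?_⟩
    intro w hw
    rcases List.mem_cons.1 (by simpa using hw) with rfl | hw
    · exact hz.1
    · exact hs w hw

/-- A vertex of a shortest walk from `r` other than its end is closer to `r` than the end. -/
theorem Walk.edist_lt_of_mem_support {G : SimpleGraph V} {r u x : V} (p : G.Walk r u)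
    (hp : (p.length : ℕ∞) = G.edist r u) (hx : x ∈ p.support) (hxu : x ≠ u) :
    G.edist r x < G.edist r u := by
  classical
  rw [← hp]
  refine (edist_le (p.takeUntil x hx)).trans_lt ?_
  exact_mod_cast length_takeUntil_lt_length hx hxu

/-- A path between two vertices at distance `i` from `r`, avoiding the vertices closer to `r`, closes
up to a cycle through shorter distances. -/
theorem exists_isCycle_of_isPath_of_edist_eq {G : SimpleGraph V} {r u v : V} {i : ℕ}
    (hu : G.edist r u = i) (hv : G.edist r v = i) (huv : u ≠ v) {p : G.Walk u v}
    (hp : p.IsPath) (hfar : ∀ x ∈ p.support, (i : ℕ∞) ≤ G.edist r x) :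
    ∃ w : G.Walk u u, w.IsCycle ∧ p.length + 2 ≤ w.length ∧ w.length ≤ p.length + 2 * i := by
  classical
  obtain ⟨a, ha⟩ := exists_walk_of_edist_eq_coe hu
  obtain ⟨b, hb⟩ := exists_walk_of_edist_eq_coe hv
  have hva : v ∉ a.support := fun h ↦
    (a.edist_lt_of_mem_support (by rw [ha, hu]) h huv.symm).ne (hv.trans hu.symm)
  have hub : u ∉ b.support := fun h ↦
    (b.edist_lt_of_mem_support (by rw [hb, hv]) h huv).ne (hu.trans hv.symm)
  set q := (b.reverse.append a).bypass with hq
  have hqp : q.IsPath := Walk.bypass_isPath _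
  have hql : q.length ≤ 2 * i := by
    have := (b.reverse.append a).length_bypass_le_length
    rw [← hq] at this
    simp only [Walk.length_append, Walk.length_reverse, ha, hb] at this
    omega
  have hne0 : q.length ≠ 0 := fun h ↦ huv.symm (Walk.eq_of_length_eq_zero h)
  have hne1 : q.length ≠ 1 := by
    intro h
    have hmem : s(v, u) ∈ q.edges := by
      match q, h with
      | .cons _ .nil, _ => simp
    have := (b.reverse.append a).edges_bypass_subset_edges hmem
    rw [Walk.edges_append, List.mem_append, Walk.edges_reverse, List.mem_reverse] at this
    rcases this with h | h
    · exact hub (b.snd_mem_support_of_mem_edges h)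
    · exact hva (a.fst_mem_support_of_mem_edges h)
  have hclose : ∀ x ∈ q.support, x ≠ u → x ≠ v → G.edist r x < i := by
    intro x hx hxu hxv
    have := (b.reverse.append a).support_bypass_subset_support hx
    rw [Walk.mem_support_append_iff, Walk.support_reverse, List.mem_reverse] at this
    rcases this with h | h
    · exact hv ▸ b.edist_lt_of_mem_support (by rw [hb, hv]) h hxv
    · exact hu ▸ a.edist_lt_of_mem_support (by rw [ha, hu]) h hxu
  refine ⟨p.append q, hp.isCycle_append hqp ?_ (Or.inr (by omega)), ?_, ?_⟩
  · intro x hxp hxq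
    have hxu : x ≠ u := by
      rintro rfl
      have := hp.support_nodup
      rw [← Walk.cons_tail_support] at this
      exact (List.nodup_cons.1 this).1 hxp
    have hxv : x ≠ v := by
      rintro rfl
      have := hqp.support_nodup
      rw [← Walk.cons_tail_support] at this
      exact (List.nodup_cons.1 this).1 hxq
    exact (hclose x (List.mem_of_mem_tail hxq) hxu hxv).not_ge (hfar x (List.mem_of_mem_tail hxp))
  · rw [Walk.length_append]; omega
  · rw [Walk.length_append]; omega

open Classical in
/-- A dense subgraph `H` lying at distance at least `i` from `r`, whose even walks preserve the
layer at distance `i`, yields a cycle of controlled length. -/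
theorem exists_isCycle_of_dense_le {G H : SimpleGraph V} (hHG : H ≤ G) {r : V} {i m : ℕ}
    (hm : Even m) (hm0 : m ≠ 0) {W : Finset V} (hW : W.Nonempty)
    (hfar : ∀ x ∈ W, (i : ℕ∞) ≤ G.edist r x)
    (hadj : ∀ x y, H.Adj x y → G.edist r x = i ∨ G.edist r y = i)
    (heven : ∀ x y (p : H.Walk x y), Even p.length → G.edist r x = i → G.edist r y = i)
    (hsum : 2 * (m : ℝ) * #W ≤ ∑ x ∈ W, (#{y ∈ W | H.Adj x y} : ℝ)) :
    ∃ (x : V) (w : G.Walk x x), w.IsCycle ∧ m + 2 ≤ w.length ∧ w.length ≤ m + 2 * i := by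
  obtain ⟨U, hUW, ⟨z, hz⟩, hU⟩ :=
    H.exists_subset_forall_lt_card_filter_adj (by positivity) hW hsum
  have hU' : ∀ x ∈ U, m < #{y ∈ U | H.Adj x y} := fun x hx ↦ by exact_mod_cast hU x hx
  obtain ⟨x, hx, hxi⟩ : ∃ x ∈ U, G.edist r x = i := by
    obtain ⟨y, hy⟩ := card_pos.1 ((Nat.zero_le m).trans_lt (hU' z hz))
    rw [mem_filter] at hy
    rcases hadj z y hy.2 with h | h
    · exact ⟨z, hz, h⟩
    · exact ⟨y, hy.1, h⟩
  obtain ⟨y, p, hp, hl, hs⟩ := H.exists_isPath_length_eq (fun x hx ↦ (hU' x hx).le) hx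
  have hxy : x ≠ y := by
    rintro rfl
    rw [(Walk.isPath_iff_nil.1 hp).length_eq_zero] at hl
    exact hm0 hl.symm
  obtain ⟨w, hw, h1, h2⟩ := exists_isCycle_of_isPath_of_edist_eq hxi
    (heven x y p (hl ▸ hm) hxi) hxy (hp.mapLe hHG)
    (fun t ht ↦ hfar t (hUW (hs t (by simpa using ht))))
  exact ⟨x, w, hw, by simpa [hl] using h1, by simpa [hl] using h2⟩

open Classical in
/-- Many edges inside one distance layer yield a cycle of controlled length. -/
theorem exists_isCycle_of_dense_layer {G : SimpleGraph V} {r : V} {i m : ℕ}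
    (hm : Even m) (hm0 : m ≠ 0) {A : Finset V} (hA : ∀ x, x ∈ A ↔ G.edist r x = i)
    (hne : A.Nonempty)
    (hsum : 2 * (m : ℝ) * #A ≤ ∑ x ∈ A, (#{y ∈ A | G.Adj x y} : ℝ)) :
    ∃ (x : V) (w : G.Walk x x), w.IsCycle ∧ m + 2 ≤ w.length ∧ w.length ≤ m + 2 * i := by
  let H : SimpleGraph V :=
    { Adj := fun x y ↦ G.Adj x y ∧ x ∈ A ∧ y ∈ A
      symm := ⟨fun x y h ↦ ⟨h.1.symm, h.2.2, h.2.1⟩⟩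
      loopless := ⟨fun x h ↦ h.1.ne rfl⟩ }
  refine exists_isCycle_of_dense_le (H := H) (fun x y h ↦ h.1) hm hm0 hne
    (fun x hx ↦ ((hA x).1 hx).ge) (fun x y h ↦ .inl ((hA x).1 h.2.1)) ?_ ?_
  · intro x y p _ hx
    cases p.reverse with
    | nil => exact hx
    | cons h _ => exact (hA y).1 h.2.1
  · refine hsum.trans_eq (sum_congr rfl fun x hx ↦ ?_)
    congr 2
    ext y
    simp +contextual [H, hx]

open Classical in
/-- Many edges between consecutive distance layers yield a cycle of controlled length. -/
theorem exists_isCycle_of_dense_between_layers {G : SimpleGraph V} {r : V} {i m : ℕ}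
    (hm : Even m) (hm0 : m ≠ 0) {A B : Finset V} (hA : ∀ x, x ∈ A ↔ G.edist r x = i)
    (hB : ∀ x, x ∈ B ↔ G.edist r x = (i + 1 : ℕ)) (hne : A.Nonempty)
    (hsum : (m : ℝ) * (#A + #B) ≤ ∑ x ∈ A, (#{y ∈ B | G.Adj x y} : ℝ)) :
    ∃ (x : V) (w : G.Walk x x), w.IsCycle ∧ m + 2 ≤ w.length ∧ w.length ≤ m + 2 * i := by
  have hdisj : Disjoint A B := by
    rw [Finset.disjoint_left]
    intro x hxA hxB
    have := ((hA x).1 hxA).symm.trans ((hB x).1 hxB)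
    norm_cast at this
    omega
  obtain ⟨H, hH⟩ : ∃ H : SimpleGraph V, ∀ x y,
      H.Adj x y ↔ G.Adj x y ∧ (x ∈ A ∧ y ∈ B ∨ x ∈ B ∧ y ∈ A) :=
    ⟨{ Adj := fun x y ↦ G.Adj x y ∧ (x ∈ A ∧ y ∈ B ∨ x ∈ B ∧ y ∈ A)
       symm := ⟨fun x y h ↦ ⟨h.1.symm, h.2.symm.imp And.symm And.symm⟩⟩
       loopless := ⟨fun x h ↦ h.1.ne rfl⟩ }, fun _ _ ↦ Iff.rfl⟩
  refine exists_isCycle_of_dense_le (H := H) (r := r) (W := A ∪ B)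
    (fun x y h ↦ ((hH x y).1 h).1) hm hm0
    (hne.mono subset_union_left) ?_ ?_ ?_ ?_
  · intro x hx
    rcases mem_union.1 hx with h | h
    · exact ((hA x).1 h).ge
    · rw [(hB x).1 h]
      exact_mod_cast i.le_succ
  · intro x y hxy
    rcases ((hH x y).1 hxy).2 with h | h
    · exact .inl ((hA x).1 h.1)
    · exact .inr ((hA y).1 h.2)
  · let c : H.Coloring Bool := Coloring.mk (fun x ↦ decide (x ∈ A)) (by
      intro x y hxy
      rcases ((hH x y).1 hxy).2 with h | h
      · simp [h.1, Finset.disjoint_right.1 hdisj h.2]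
      · simp [h.2, Finset.disjoint_right.1 hdisj h.1])
    intro x y p hp hx
    have := (c.even_length_iff_congr p).1 hp
    rw [← hA] at hx ⊢
    simpa [c, Coloring.mk, hx] using this
  · have h1 : ∑ x ∈ A, (#{y ∈ A ∪ B | H.Adj x y} : ℝ) = ∑ x ∈ A, (#{y ∈ B | G.Adj x y} : ℝ) := by
      refine sum_congr rfl fun x hx ↦ ?_
      congr 2
      ext y
      have := Finset.disjoint_left.1 hdisj hx
      simp only [hH, mem_filter, mem_union]
      tauto
    have h2 : ∑ x ∈ B, (#{y ∈ A ∪ B | H.Adj x y} : ℝ) = ∑ x ∈ B, (#{y ∈ A | G.Adj x y} : ℝ) := by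
      refine sum_congr rfl fun x hx ↦ ?_
      congr 2
      ext y
      have := Finset.disjoint_right.1 hdisj hx
      simp only [hH, mem_filter, mem_union]
      tauto
    have h3 : ∑ x ∈ B, (#{y ∈ A | G.Adj x y} : ℝ) = ∑ x ∈ A, (#{y ∈ B | G.Adj x y} : ℝ) := by
      simp only [← sum_boole]
      rw [sum_comm]
      simp_rw [G.adj_comm]
    rw [sum_union hdisj, h1, h2, h3, card_union_of_disjoint hdisj]
    push_cast
    linarith

/-- Distances from `r` to adjacent vertices differ by at most one. -/
theorem edist_cases_of_adj {G : SimpleGraph V} {r x y : V} {i : ℕ} (hx : G.edist r x = i)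
    (h : G.Adj x y) :
    G.edist r y + 1 = i ∨ G.edist r y = i ∨ G.edist r y = (i + 1 : ℕ) := by
  have h1 : G.edist r y ≤ i + 1 := by
    have := G.edist_triangle (u := r) (v := x) (w := y)
    rwa [hx, edist_eq_one_iff_adj.2 h] at this
  have h2 : (i : ℕ∞) ≤ G.edist r y + 1 := by
    have := G.edist_triangle (u := r) (v := y) (w := x)
    rwa [hx, edist_eq_one_iff_adj.2 h.symm] at this
  have hne : G.edist r y ≠ ⊤ := ne_top_of_le_ne_top (by exact_mod_cast ENat.natCast_ne_top _) h1
  obtain ⟨j, hj⟩ := ENat.ne_top_iff_exists.1 hne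
  rw [← hj] at h1 h2 ⊢
  norm_cast at h1 h2 ⊢
  omega

/-- Among finite layers starting from a single vertex, some layer expands by a factor less than `γ`
to the next, while the number of layers up to it is at most logarithmic. -/
theorem exists_lt_mul_and_pow_le {a : ℕ → ℕ} {N : ℕ} (h0 : a 0 = 1) (hN : ∀ i, a i ≤ N)
    {γ : ℝ} (hγ : 1 < γ) :
    ∃ i, (a (i + 1) : ℝ) < γ * a i ∧ γ ^ i ≤ a i ∧ (∀ j, j + 1 = i → a j ≤ a i) := by
  classical
  have hpow : ∀ i, (∀ j < i, γ * a j ≤ a (j + 1)) → γ ^ i ≤ a i := by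
    intro i
    induction i with
    | zero => simp [h0]
    | succ i ih =>
      intro h
      have h1 := ih fun j hj ↦ h j (by omega)
      have h2 := h i (by omega)
      rw [pow_succ']
      exact (mul_le_mul_of_nonneg_left h1 (by linarith)).trans h2
  have hex : ∃ i, (a (i + 1) : ℝ) < γ * a i := by
    by_contra! h
    obtain ⟨n, hn⟩ := pow_unbounded_of_one_lt (N : ℝ) hγ
    have h1 := hpow n fun j _ ↦ h j
    have h2 : (a n : ℝ) ≤ N := by exact_mod_cast hN n
    linarith
  have hmin : ∀ j < Nat.find hex, γ * a j ≤ a (j + 1) := fun j hj ↦ not_lt.1 (Nat.find_min hex hj)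
  refine ⟨Nat.find hex, Nat.find_spec hex, hpow _ hmin, ?_⟩
  intro j hj
  have h1 := hmin j (by omega)
  rw [hj] at h1
  have h2 : (0 : ℝ) ≤ a j := by positivity
  have h3 : (a j : ℝ) ≤ a (Nat.find hex) := by nlinarith
  exact_mod_cast h3

open Classical in
/-- A graph with a vertex `r` all of whose reachable vertices have degree at least `8 * γ * d`
contains a cycle whose length exceeds the even number `m ≤ d` by a controlled amount. -/
theorem exists_isCycle_of_forall_le_degree [Fintype V] {G : SimpleGraph V} {γ d : ℝ} (hγ : 1 < γ)
    {r : V} (hdeg : ∀ x, G.Reachable r x → 8 * γ * d ≤ #{y | G.Adj x y}) {m : ℕ}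
    (hm : Even m) (hm0 : m ≠ 0) (hmd : m ≤ d) :
    ∃ (i : ℕ) (x : V) (w : G.Walk x x), γ ^ i ≤ Fintype.card V ∧ w.IsCycle ∧
      m + 2 ≤ w.length ∧ w.length ≤ m + 2 * i := by
  let L : ℕ → Finset V := fun i ↦ {x | G.edist r x = i}
  have hL : ∀ i x, x ∈ L i ↔ G.edist r x = i := fun i x ↦ by simp [L]
  have hL0 : #(L 0) = 1 := by
    rw [card_eq_one]
    refine ⟨r, ?_⟩
    ext x
    simp [L, eq_comm (a := x)]
  obtain ⟨i, hlt, hpow, hprev⟩ :=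
    exists_lt_mul_and_pow_le (a := fun i ↦ #(L i)) hL0 (fun i ↦ card_le_univ _) hγ
  have hN : γ ^ i ≤ Fintype.card V := hpow.trans (by exact_mod_cast card_le_univ _)
  have hpos : (0 : ℝ) < #(L i) := lt_of_lt_of_le (pow_pos (by linarith) i) hpow
  have hne : (L i).Nonempty := card_pos.1 (by exact_mod_cast hpos)
  have hmpos : (0 : ℝ) < m := by positivity
  have hd : 0 < d := by linarith
  have hγd : d ≤ γ * d := by nlinarith
  let P : Finset V := {x | G.edist r x + 1 = i}
  have htotal : 8 * γ * d * #(L i) ≤ ∑ x ∈ L i, (#{y ∈ P | G.Adj x y} : ℝ) +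
      ∑ x ∈ L i, (#{y ∈ L i | G.Adj x y} : ℝ) +
      ∑ x ∈ L i, (#{y ∈ L (i + 1) | G.Adj x y} : ℝ) := by
    rw [← sum_add_distrib, ← sum_add_distrib, mul_comm, ← nsmul_eq_mul]
    refine card_nsmul_le_sum _ _ _ fun x hx ↦ ?_
    rw [hL] at hx
    refine (hdeg x (reachable_of_edist_ne_top (by simp [hx]))).trans ?_
    have hsub : ({y | G.Adj x y} : Finset V) ⊆ ({y ∈ P | G.Adj x y} ∪ {y ∈ L i | G.Adj x y}) ∪
        {y ∈ L (i + 1) | G.Adj x y} := by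
      intro y hy
      have hxy : G.Adj x y := by simpa using hy
      have := edist_cases_of_adj hx hxy
      simp only [mem_union, mem_filter, hL, P, hxy, and_true, mem_univ, true_and]
      tauto
    have h1 := (card_le_card hsub).trans (card_union_le _ _)
    have h2 := h1.trans (Nat.add_le_add_right (card_union_le _ _) _)
    exact_mod_cast h2
  rcases le_or_gt (2 * (m : ℝ) * #(L i)) (∑ x ∈ L i, (#{y ∈ L i | G.Adj x y} : ℝ)) with h1 | h1
  · obtain ⟨x, w, h⟩ := exists_isCycle_of_dense_layer hm hm0 (hL i) hne h1
    exact ⟨i, x, w, hN, h⟩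
  rcases le_or_gt ((m : ℝ) * (#(L i) + #(L (i + 1))))
    (∑ x ∈ L i, (#{y ∈ L (i + 1) | G.Adj x y} : ℝ)) with h2 | h2
  · obtain ⟨x, w, h⟩ := exists_isCycle_of_dense_between_layers hm hm0 (hL i) (hL (i + 1)) hne h2
    exact ⟨i, x, w, hN, h⟩
  have hP : 2 * (m : ℝ) * #(L i) < ∑ x ∈ L i, (#{y ∈ P | G.Adj x y} : ℝ) := by
    have e1 : (m : ℝ) * (#(L i) + #(L (i + 1))) ≤ 2 * (γ * d) * #(L i) := by
      have e2 : (#(L i) + #(L (i + 1)) : ℝ) ≤ 2 * γ * #(L i) := by nlinarith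
      calc (m : ℝ) * (#(L i) + #(L (i + 1))) ≤ d * (2 * γ * #(L i)) := by gcongr
        _ = _ := by ring
    have e3 : (m : ℝ) * #(L i) ≤ γ * d * #(L i) := by
      gcongr
      linarith
    have e4 : 0 < γ * d * #(L i) := by positivity
    linarith
  cases i with
  | zero =>
    have : P = ∅ := by simp [P]
    rw [this] at hP
    simp at hP
    nlinarith
  | succ j =>
    have hPL : P = L j := by
      ext x
      rw [hL]
      simp only [P, mem_filter, mem_univ, true_and]
      push_cast
      exact (ENat.add_left_injective_of_ne_top ENat.one_ne_top).eq_iff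
    have hle : (#(L j) : ℝ) ≤ #(L (j + 1)) := by exact_mod_cast hprev j rfl
    have hswap : ∑ x ∈ L (j + 1), (#{y ∈ L j | G.Adj x y} : ℝ) =
        ∑ x ∈ L j, (#{y ∈ L (j + 1) | G.Adj x y} : ℝ) := by
      simp only [← sum_boole]
      rw [sum_comm]
      simp_rw [G.adj_comm]
    rw [hPL, hswap] at hP
    have hne' : (L j).Nonempty := by
      rw [nonempty_iff_ne_empty]
      intro he
      rw [he] at hP
      simp at hP
      nlinarith
    obtain ⟨x, w, hw, h3, h4⟩ := exists_isCycle_of_dense_between_layers hm hm0 (hL j) (hL (j + 1))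
      hne' (by nlinarith)
    exact ⟨j + 1, x, w, hN, hw, h3, by omega⟩

end SimpleGraph

/-- Approximate-length cycle lemma: if `G` is a graph on `N` vertices with average degree
`d(G) ≥ 16 γ d₁` where `γ > 1` and `d₁ ≥ 2`, then `G` contains a cycle of some length `ℓ`
with `d₁ ≤ ℓ ≤ d₁ + 2 log N / log γ`. -/
theorem stmt18 {V : Type*} [Fintype V] [DecidableEq V] [Nonempty V]
    (G : SimpleGraph V) [DecidableRel G.Adj]
    (γ d₁ : ℝ) (hγ : 1 < γ) (hd₁ : 2 ≤ d₁)
    (hd : 16 * γ * d₁ ≤ 2 * (G.edgeFinset.card : ℝ) / (Fintype.card V : ℝ)) :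
    ∃ (ℓ : ℕ) (x : V) (w : G.Walk x x), w.IsCycle ∧ w.length = ℓ ∧
      d₁ ≤ (ℓ : ℝ) ∧
      (ℓ : ℝ) ≤ d₁ + 2 * Real.log (Fintype.card V) / Real.log γ := by
  classical
  have hN : (0 : ℝ) < Fintype.card V := by exact_mod_cast Fintype.card_pos
  have hsum : 2 * (8 * γ * d₁) * (Finset.univ : Finset V).card ≤
      ∑ x : V, ((Finset.univ.filter fun y ↦ G.Adj x y).card : ℝ) := by
    have h1 := G.sum_degrees_eq_twice_card_edges
    have h2 : ∑ x : V, ((Finset.univ.filter fun y ↦ G.Adj x y).card : ℝ) =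
        2 * (G.edgeFinset.card : ℝ) := by
      rw [← Nat.cast_ofNat, ← Nat.cast_mul, ← h1, Nat.cast_sum]
      refine Finset.sum_congr rfl fun x _ ↦ ?_
      rw [← G.card_neighborFinset_eq_degree]
      congr 2
      ext y
      simp
    rw [le_div_iff₀ hN] at hd
    rw [h2, Finset.card_univ]
    linarith
  have hpos : 0 < 8 * γ * d₁ := by positivity
  obtain ⟨U, -, ⟨r, hr⟩, hU⟩ :=
    G.exists_subset_forall_lt_card_filter_adj hpos Finset.univ_nonempty (by convert hsum)
  obtain ⟨G', hG'⟩ : ∃ G' : SimpleGraph V, ∀ x y, G'.Adj x y ↔ G.Adj x y ∧ x ∈ U ∧ y ∈ U :=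
    ⟨{ Adj := fun x y ↦ G.Adj x y ∧ x ∈ U ∧ y ∈ U
       symm := ⟨fun x y h ↦ ⟨h.1.symm, h.2.2, h.2.1⟩⟩
       loopless := ⟨fun x h ↦ h.1.ne rfl⟩ }, fun _ _ ↦ Iff.rfl⟩
  have hreach : ∀ x, G'.Reachable r x → x ∈ U := by
    rintro x ⟨p⟩
    cases p.reverse with
    | nil => exact hr
    | cons h _ => exact ((hG' _ _).1 h).2.1
  have hdeg : ∀ x, G'.Reachable r x →
      8 * γ * d₁ ≤ (Finset.univ.filter fun y ↦ G'.Adj x y).card := by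
    intro x hx
    have hxU := hreach x hx
    refine (hU x hxU).le.trans_eq ?_
    congr 2
    ext y
    simp [hG', hxU, and_comm]
  have hfl : 1 ≤ ⌊d₁ / 2⌋₊ := Nat.le_floor (by push_cast; linarith)
  have hfle : (⌊d₁ / 2⌋₊ : ℝ) ≤ d₁ / 2 := Nat.floor_le (by linarith)
  have hflt : d₁ / 2 < ⌊d₁ / 2⌋₊ + 1 := Nat.lt_floor_add_one _
  obtain ⟨i, x, w, hi, hw, h1, h2⟩ := SimpleGraph.exists_isCycle_of_forall_le_degree (G := G') hγ
    hdeg (m := 2 * ⌊d₁ / 2⌋₊) (even_two_mul _) (by omega) (by push_cast; linarith)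
  have hle : G' ≤ G := fun x y h ↦ ((hG' x y).1 h).1
  have hlog : (i : ℝ) ≤ Real.log (Fintype.card V) / Real.log γ := by
    rw [le_div_iff₀ (Real.log_pos hγ), ← Real.log_pow]
    exact Real.log_le_log (by positivity) hi
  have h1' : (2 * ⌊d₁ / 2⌋₊ + 2 : ℝ) ≤ w.length := by exact_mod_cast h1
  have h2' : (w.length : ℝ) ≤ 2 * ⌊d₁ / 2⌋₊ + 2 * i := by exact_mod_cast h2
  refine ⟨w.length, x, w.mapLe hle, hw.mapLe hle, by simp, by linarith, ?_⟩
  rw [mul_div_assoc]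
  linarith
end
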